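/- arXiv:math/9908154 — 2 statements merged into one kernel-verified Lean document; each statement's English description precedes it below -/
import Mathlib

section
/- Let ω be a real-valued continuous function on the open unit disk D belonging to L^1(D). If h₁ and h₂ are both best harmonic approximants to ω in L^1(D) (i.e. ‖ω − h₁‖_1 = ‖ω − h₂‖_1 = inf{‖ω − h‖_1 : h ∈ L^1_h(D)}) and the difference h₁ − h₂ is bounded on D, then h₁ = h₂. -/
open MeasureTheory Metric Complex
open scoped ENNReal

/-- The normalized area measure `dA = (1/π) dx dy` on the open unit disk. -/
noncomputable def dA : Measure ℂ :=
  (ENNReal.ofReal (1 / Real.pi)) • ((volume : Measure ℂ).restrict (ball (0 : ℂ) 1))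

/-- A real-valued function on `ℂ` is harmonic on `U` if it is `C²` there and its
Laplacian (computed with respect to the real directions `1` and `I`) vanishes on `U`. -/
def HarmonicOnR (f : ℂ → ℝ) (U : Set ℂ) : Prop :=
  ContDiffOn ℝ 2 f U ∧ ∀ z ∈ U,
    fderiv ℝ (fun w => fderiv ℝ f w 1) z 1
      + fderiv ℝ (fun w => fderiv ℝ f w Complex.I) z Complex.I = 0

/-- Membership in `L¹_h(D)` (real-valued). -/
def MemL1h (h : ℂ → ℝ) : Prop :=
  HarmonicOnR h (ball (0 : ℂ) 1) ∧ Integrable h dA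


open InnerProductSpace Laplacian in
lemma harmonicOnR_iff (f : ℂ → ℝ) :
    HarmonicOnR f (ball (0:ℂ) 1) ↔ HarmonicOnNhd f (ball (0:ℂ) 1) := by
  have key : ∀ z ∈ ball (0:ℂ) 1, ContDiffAt ℝ 2 f z →
      fderiv ℝ (fun w => fderiv ℝ f w 1) z 1
      + fderiv ℝ (fun w => fderiv ℝ f w Complex.I) z Complex.I = Δ f z := by
    intro z hz h
    have hd : DifferentiableAt ℝ (fderiv ℝ f) z :=
      (h.fderiv_right (m := 1) (by norm_num)).differentiableAt (by norm_num)
    rw [laplacian_eq_iteratedFDeriv_complexPlane]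
    simp only [iteratedFDeriv_two_apply]
    rw [fderiv_clm_apply hd (by fun_prop), fderiv_clm_apply hd (by fun_prop)]
    simp
  constructor
  · rintro ⟨h1, h2⟩ z hz
    refine ⟨h1.contDiffAt (isOpen_ball.mem_nhds hz), ?_⟩
    filter_upwards [isOpen_ball.mem_nhds hz] with w hw
    rw [← key w hw (h1.contDiffAt (isOpen_ball.mem_nhds hw))]
    exact h2 w hw
  · intro h
    refine ⟨h.contDiffOn, fun z hz => ?_⟩
    rw [key z hz (h z hz).1]
    exact (h z hz).2.self_of_nhds

instance : IsFiniteMeasure dA := by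
  unfold dA
  have : IsFiniteMeasure ((volume : Measure ℂ).restrict (ball (0 : ℂ) 1)) :=
    ⟨by simp⟩
  exact Measure.smul_finite _ (by simp)

lemma ae_dA {p : ℂ → Prop} (h : ∀ z ∈ ball (0:ℂ) 1, p z) : ∀ᵐ z ∂dA, p z := by
  unfold dA
  apply Measure.ae_smul_measure
  exact (ae_restrict_mem measurableSet_ball).mono h

lemma dA_abs : dA ≪ (volume : Measure ℂ) := by
  unfold dA
  exact (Measure.AbsolutelyContinuous.smul_left Measure.absolutelyContinuous_restrict _ )

/-- maximum principle -/
lemma maxprin (G F : ℂ → ℂ) (C M : ℝ) (hF : AnalyticOnNhd ℂ F (ball 0 1))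
    (hG : ∀ z ∈ ball (0:ℂ) 1, 0 < (F z).re → DifferentiableAt ℂ G z)
    (hC : ∀ z ∈ ball (0:ℂ) 1, ‖G z‖ ≤ C) (hM : ∀ z ∈ ball (0:ℂ) 1, (F z).re ≤ M)
    (hbd : ∀ δ > 0, ∃ r < 1, ∀ z : ℂ, r ≤ ‖z‖ → ‖z‖ < 1 → ‖G z‖ ≤ δ) 
    (z : ℂ) (hz : z ∈ ball (0:ℂ) 1) (hpos : 0 < (F z).re) : G z = 0 := by
  have hC' : 0 < C + 1 := by linarith [norm_nonneg (G z), hC z hz]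
  set ε := (F z).re / 2 with hε
  have hε0 : 0 < ε := by positivity
  have main : ∀ N : ℕ, ‖G z‖ * Real.exp (N * ε) ≤ C + 1 := by
    intro N
    obtain ⟨r, hr1, hr⟩ := hbd ((C+1) * Real.exp (-(N * M))) (by positivity)
    rw [mem_ball_zero_iff] at hz
    obtain ⟨ρ, hρ1, hρ2⟩ := exists_between (max_lt hr1 hz)
    have hρr : r < ρ := (le_max_left _ _).trans_lt hρ1
    have hρz : ‖z‖ < ρ := (le_max_right _ _).trans_lt hρ1
    set U : Set ℂ := ball 0 ρ ∩ {w | ε < (F w).re} with hU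
    have hFc : ContinuousOn F (closedBall 0 ρ) := hF.continuousOn.mono
      (closedBall_subset_ball hρ2)
    have hRc : ContinuousOn (fun w => (F w).re) (closedBall 0 ρ) :=
      Complex.continuous_re.comp_continuousOn hFc
    have hUo : IsOpen U := by
      have := (hRc.mono ball_subset_closedBall).isOpen_inter_preimage isOpen_ball (isOpen_Ioi (a := ε))
      exact this
    have hcl : closure U ⊆ closedBall 0 ρ ∩ {w | ε ≤ (F w).re} := by
      have hc : IsClosed (closedBall 0 ρ ∩ {w | ε ≤ (F w).re}) := 
        hRc.preimage_isClosed_of_isClosed isClosed_closedBall (isClosed_Ici (a := ε))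
      exact closure_minimal (fun w hw => ⟨ball_subset_closedBall hw.1, by
        have h2 := hw.2
        simp only [Set.mem_ofPred_eq] at h2 ⊢
        exact h2.le⟩) hc
    set H : ℂ → ℂ := fun w => G w * Complex.exp (N * F w) with hH
    have hHn : ∀ w, ‖H w‖ = ‖G w‖ * Real.exp (N * (F w).re) := by
      intro w
      simp [hH, Complex.norm_exp]
    have hdiff : ∀ w ∈ closure U, DifferentiableAt ℂ H w := by
      intro w hw
      have hw' := hcl hw
      have hwb : w ∈ ball (0:ℂ) 1 := closedBall_subset_ball hρ2 hw'.1
      have h1 := hG w hwb (hε0.trans_le hw'.2)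
      have h2 := (hF w hwb).differentiableAt
      fun_prop
    have hfr : ∀ w ∈ frontier U, ‖H w‖ ≤ (C+1) * Real.exp (N * ε) := by
      intro w hw
      have hw' := hcl (frontier_subset_closure hw)
      have hwb : w ∈ ball (0:ℂ) 1 := closedBall_subset_ball hρ2 hw'.1
      have hwU : w ∉ U := by
        rw [hUo.frontier_eq] at hw; exact hw.2
      rw [hHn]
      by_cases h : w ∈ ball (0:ℂ) ρ
      · have : (F w).re ≤ ε := by
          by_contra hh
          exact hwU ⟨h, not_le.mp hh⟩
        gcongr
        linarith [hC w hwb]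
      · have h3 : ρ ≤ ‖w‖ := by simpa using h
        have h4 := hr w (hρr.le.trans h3) (by simpa using hwb)
        calc ‖G w‖ * Real.exp (N * (F w).re) 
            ≤ ((C+1) * Real.exp (-(N * M))) * Real.exp (N * M) := by
              gcongr
              exact hM w hwb
          _ = C + 1 := by rw [mul_assoc, ← Real.exp_add]; simp
          _ ≤ _ := le_mul_of_one_le_right hC'.le (Real.one_le_exp (by positivity))
    have := Complex.norm_le_of_forall_mem_frontier_norm_le (U := U) (f := H)
      (isBounded_ball.subset Set.inter_subset_left)
      ⟨fun w hw => (hdiff w (subset_closure hw)).differentiableWithinAt,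
        fun w hw => (hdiff w hw).continuousAt.continuousWithinAt⟩ hfr
      (subset_closure ⟨by simpa using hρz, by simp only [Set.mem_ofPred_eq]; linarith⟩)
    rw [hHn, show N * (F z).re = N * ε + N * ε by rw [hε]; ring, Real.exp_add, ← mul_assoc] at this
    exact le_of_mul_le_mul_right this (Real.exp_pos _)
  by_contra hne
  have hg : 0 < ‖G z‖ := norm_pos_iff.mpr hne
  obtain ⟨N, hN⟩ := exists_nat_gt ((C + 1) / (‖G z‖ * ε))
  have h1 := main N
  have h2 : (N * ε : ℝ) + 1 ≤ Real.exp (N * ε) := Real.add_one_le_exp _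
  rw [div_lt_iff₀ (by positivity)] at hN
  nlinarith
lemma null_zero (F : ℂ → ℂ) (hF : AnalyticOnNhd ℂ F (ball 0 1))
    (z0 : ℂ) (hz0 : z0 ∈ ball (0:ℂ) 1) (h0 : (F z0).re ≠ 0) :
    volume {z | z ∈ ball (0:ℂ) 1 ∧ (F z).re = 0} = 0 := by
  have hpc : IsPreconnected (ball (0:ℂ) 1) := (convex_ball (0:ℂ) 1).isPreconnected
  have hline : volume {w : ℂ | w.re = 0} = 0 := by
    have := Measure.addHaar_submodule (volume : Measure ℂ) (LinearMap.ker (Complex.reLm))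
      (by
        intro h
        have : (1:ℂ) ∈ LinearMap.ker (Complex.reLm) := by rw [h]; trivial
        simp at this)
    convert this using 2
    ext; simp
  have hdF : AnalyticOnNhd ℂ (deriv F) (ball 0 1) := hF.deriv
  by_cases hconst : Set.EqOn (deriv F) 0 (ball 0 1)
  · have hc : ∀ z ∈ ball (0:ℂ) 1, F z = F z0 := fun z hz =>
      isOpen_ball.is_const_of_deriv_eq_zero hpc hF.differentiableOn hconst hz hz0
    convert measure_empty (μ := (volume : Measure ℂ))
    ext z
    simp only [Set.mem_ofPred_eq, Set.mem_empty_iff_false, iff_false, not_and]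
    intro hz
    rw [hc z hz]; exact h0
  · have hcrit : volume {z | z ∈ ball (0:ℂ) 1 ∧ deriv F z = 0} = 0 := by
      have h1 := (hdF.eqOn_zero_or_eventually_ne_zero_of_preconnected hpc).resolve_left hconst
      have h2 := ae_restrict_le_codiscreteWithin (μ := (volume : Measure ℂ)) measurableSet_ball h1
      rw [mem_ae_iff, Measure.restrict_apply' measurableSet_ball] at h2
      refine measure_mono_null ?_ h2
      intro z hz
      exact ⟨by simpa using hz.2, hz.1⟩
    have hreg : volume {z | z ∈ ball (0:ℂ) 1 ∧ (F z).re = 0 ∧ deriv F z ≠ 0} = 0 := by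
      apply measure_null_of_locally_null
      rintro a ⟨ha, -, ha'⟩
      have hs : HasStrictDerivAt F (deriv F a) a := (hF a ha).hasStrictDerivAt
      have hcd : ContDiffAt ℂ 1 F a := (hF a ha).contDiffAt
      let e := (hs.hasStrictFDerivAt_equiv ha').toOpenPartialHomeomorph F
      have hae : a ∈ e.source := (hs.hasStrictFDerivAt_equiv ha').mem_toOpenPartialHomeomorph_source
      have heF : (e : ℂ → ℂ) = F := rfl
      let V : Set ℂ := {z | z ∈ ball (0:ℂ) 1 ∧ deriv F z ≠ 0} ∩ e.source
      have hVo : V ∈ nhds a := by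
        refine Filter.inter_mem ?_ (e.open_source.mem_nhds hae)
        filter_upwards [isOpen_ball.mem_nhds ha, (hdF a ha).continuousAt.eventually_ne ha'] with z h1 h2
        exact ⟨h1, h2⟩
      refine ⟨{z | z ∈ V ∧ (F z).re = 0}, ?_, ?_⟩
      · rw [mem_nhdsWithin_iff_exists_mem_nhds_inter]
        exact ⟨V, hVo, fun z hz => ⟨hz.1, hz.2.2.1⟩⟩
      · have hsub : {z | z ∈ V ∧ (F z).re = 0} ⊆ e.symm '' (F '' V ∩ {w | w.re = 0}) := by
          rintro z ⟨hz, hz0⟩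
          exact ⟨F z, ⟨⟨z, hz, rfl⟩, hz0⟩, e.left_inv hz.2⟩
        refine measure_mono_null hsub ?_
        apply addHaar_image_eq_zero_of_differentiableOn_of_addHaar_eq_zero
        · rintro w ⟨⟨z, hz, rfl⟩, -⟩
          have h1 : HasDerivAt F (deriv F z) z := (hF z hz.1.1).differentiableAt.hasDerivAt
          have h2 : e.symm (F z) = z := e.left_inv hz.2
          have h3 : HasDerivAt e.symm (deriv F z)⁻¹ (F z) := by
            apply e.hasDerivAt_symm (e.map_source hz.2) hz.1.2
            rw [heF, h2]; exact h1
          exact (h3.differentiableAt.restrictScalars ℝ).differentiableWithinAt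
        · exact measure_mono_null Set.inter_subset_right hline
    refine measure_mono_null (fun z hz => ?_) (measure_union_null hcrit hreg)
    by_cases h : deriv F z = 0
    · exact Or.inl ⟨hz.1, h⟩
    · exact Or.inr ⟨hz.1, hz.2, h⟩
/-- kernel -/
noncomputable def kk (z : ℂ) : ℝ := (√‖z‖)⁻¹ ^ 3

lemma kk_nonneg (z : ℂ) : 0 ≤ kk z := by unfold kk; positivity

lemma kk_int : IntegrableOn kk (ball (0:ℂ) 3) := by
  have : IntegrableOn (fun z : ℂ => (fun t : ℝ => (√t)⁻¹ ^ 3) ‖z‖) (ball (0:ℂ) 3) := by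
    refine (integrableOn_fun_norm_addHaar (volume : Measure ℂ) (f := fun t : ℝ => (√t)⁻¹ ^ 3)).2 ?_
    have h : IntegrableOn (fun t : ℝ => t ^ (-(1/2) : ℝ)) (Set.Ioo 0 3) := by
      have := (intervalIntegral.intervalIntegrable_rpow' (a := 0) (b := 3) (r := -(1/2)) (by norm_num))
      rw [intervalIntegrable_iff_integrableOn_Ioo_of_le (by norm_num)] at this
      exact this
    refine h.congr_fun (fun t ht => ?_) measurableSet_Ioo
    have ht0 : 0 < t := ht.1
    simp only [Complex.finrank_real_complex, smul_eq_mul]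
    rw [Real.rpow_neg ht0.le, ← Real.sqrt_eq_rpow]
    have h1 : 0 < √t := Real.sqrt_pos.2 ht0
    have h2 : √t * √t = t := Real.mul_self_sqrt ht0.le
    field_simp
    rw [pow_two, h2]; simp
  exact this

noncomputable def AA : ℝ := ∫ z in ball (0:ℂ) 3, kk z

lemma kk_shift (ζ : ℂ) (hζ : ‖ζ‖ ≤ 2) :
    IntegrableOn (fun z => kk (z - ζ)) (ball (0:ℂ) 1) ∧
    ∫ z in ball (0:ℂ) 1, kk (z - ζ) ≤ AA := by
  have h1 : Integrable ((ball (0:ℂ) 3).indicator kk) := by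
    rw [integrable_indicator_iff measurableSet_ball]; exact kk_int
  have h2 := h1.comp_sub_right ζ
  have h3 : ∀ z ∈ ball (0:ℂ) 1, (ball (0:ℂ) 3).indicator kk (z - ζ) = kk (z - ζ) := by
    intro z hz
    apply Set.indicator_of_mem
    rw [mem_ball_zero_iff] at *
    linarith [norm_sub_le z ζ]
  constructor
  · exact (h2.integrableOn (s := ball (0:ℂ) 1)).congr_fun h3 measurableSet_ball
  · rw [← setIntegral_congr_fun measurableSet_ball h3]
    refine (setIntegral_le_integral h2 ?_).trans ?_
    · exact Filter.Eventually.of_forall fun z => Set.indicator_nonneg (fun w _ => kk_nonneg w) _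
    · rw [integral_sub_right_eq_self (fun z => (ball (0:ℂ) 3).indicator kk z) ζ,
        integral_indicator measurableSet_ball]
      exact le_rfl

noncomputable def CC : ℝ := (1 / Real.pi) * AA

lemma integral_dA {E : Type*} [NormedAddCommGroup E] [NormedSpace ℝ E] (f : ℂ → E) :
    ∫ z, f z ∂dA = (1 / Real.pi) • ∫ z in ball (0:ℂ) 1, f z := by
  unfold dA
  rw [integral_smul_measure, ENNReal.toReal_ofReal (by positivity)]

lemma integrable_dA {E : Type*} [NormedAddCommGroup E] {f : ℂ → E} 
    (hf : IntegrableOn f (ball (0:ℂ) 1)) : Integrable f dA := by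
  unfold dA
  exact Integrable.smul_measure hf (by simp)

lemma dA_one : ∫ _z, (1:ℝ) ∂dA = 1 := by
  rw [integral_dA]
  simp [Measure.real, Complex.volume_ball, Real.pi_ne_zero]

lemma kk_dA (ζ : ℂ) (hζ : ‖ζ‖ ≤ 2) :
    Integrable (fun z => kk (z - ζ)) dA ∧ ∫ z, kk (z - ζ) ∂dA ≤ CC := by
  refine ⟨integrable_dA (kk_shift ζ hζ).1, ?_⟩
  rw [integral_dA]
  unfold CC
  rw [smul_eq_mul]
  gcongr
  exact (kk_shift ζ hζ).2

lemma inv_le_kk (z : ℂ) : ‖z⁻¹‖ ≤ 1 + kk z := by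
  unfold kk
  have : ‖z⁻¹‖ = (√‖z‖)⁻¹ ^ 2 := by
    rw [norm_inv, inv_pow, Real.sq_sqrt (norm_nonneg _)]
  rw [this]
  have h : 0 ≤ (√‖z‖)⁻¹ := by positivity
  nlinarith [sq_nonneg ((√‖z‖)⁻¹ - 1), mul_nonneg h (sq_nonneg ((√‖z‖)⁻¹ - 1))]

lemma diff_le_kk (z ζ ξ : ℂ) (h1 : z ≠ ζ) (h2 : z ≠ ξ) :
    ‖(z - ζ)⁻¹ - (z - ξ)⁻¹‖ ≤ √‖ζ - ξ‖ * (kk (z - ζ) + kk (z - ξ)) := by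
  have h1' : z - ζ ≠ 0 := sub_ne_zero.2 h1
  have h2' : z - ξ ≠ 0 := sub_ne_zero.2 h2
  have e : (z - ζ)⁻¹ - (z - ξ)⁻¹ = (ζ - ξ) * (z - ζ)⁻¹ * (z - ξ)⁻¹ := by
    field_simp
    ring
  rw [e, norm_mul, norm_mul, norm_inv, norm_inv]
  unfold kk
  set a := √‖z - ζ‖
  set b := √‖z - ξ‖
  set d := √‖ζ - ξ‖
  have ha : 0 < a := Real.sqrt_pos.2 (norm_pos_iff.2 h1')
  have hb : 0 < b := Real.sqrt_pos.2 (norm_pos_iff.2 h2')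
  have hd : 0 ≤ d := Real.sqrt_nonneg _
  have ea : ‖z - ζ‖ = a ^ 2 := (Real.sq_sqrt (norm_nonneg _)).symm
  have eb : ‖z - ξ‖ = b ^ 2 := (Real.sq_sqrt (norm_nonneg _)).symm
  have ed : ‖ζ - ξ‖ = d ^ 2 := (Real.sq_sqrt (norm_nonneg _)).symm
  have tri : ‖ζ - ξ‖ ≤ ‖z - ζ‖ + ‖z - ξ‖ := by
    calc ‖ζ - ξ‖ = ‖(z - ξ) - (z - ζ)‖ := by congr 1; ring
      _ ≤ _ := by rw [add_comm]; exact norm_sub_le _ _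
  rw [ea, eb, ed] at *
  have hdab : d ≤ a + b := by
    by_contra! h
    nlinarith [mul_pos ha hb]
  have key : (a + b) * (a⁻¹ ^ 2 * b⁻¹ ^ 2) ≤ a⁻¹ ^ 3 + b⁻¹ ^ 3 := by
    have hs : 0 < a⁻¹ := by positivity
    have ht : 0 < b⁻¹ := by positivity
    have : (a + b) * (a⁻¹ ^ 2 * b⁻¹ ^ 2) = a⁻¹ * b⁻¹ * (a⁻¹ + b⁻¹) := by
      field_simp
      ring
    rw [this]
    nlinarith [mul_nonneg (add_pos hs ht).le (sq_nonneg (a⁻¹ - b⁻¹))]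
  calc d ^ 2 * (a ^ 2)⁻¹ * (b ^ 2)⁻¹ = d * (d * (a⁻¹ ^ 2 * b⁻¹ ^ 2)) := by
        rw [inv_pow, inv_pow]; ring
    _ ≤ d * ((a + b) * (a⁻¹ ^ 2 * b⁻¹ ^ 2)) := by gcongr
    _ ≤ _ := by gcongr

lemma inv_meas (ζ : ℂ) : Measurable (fun z : ℂ => (z - ζ)⁻¹) := by fun_prop

lemma inv_int (ζ : ℂ) (hζ : ‖ζ‖ ≤ 2) : Integrable (fun z : ℂ => (z - ζ)⁻¹) dA := by
  refine Integrable.mono' ((integrable_const (1:ℝ)).add (kk_dA ζ hζ).1)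
    (inv_meas ζ).aestronglyMeasurable ?_
  exact Filter.Eventually.of_forall fun z => inv_le_kk _

lemma phi_int (φ : ℂ → ℂ) (hφ : AEStronglyMeasurable φ dA) (B : ℝ) (hB : ∀ z, ‖φ z‖ ≤ B)
    (ζ : ℂ) (hζ : ‖ζ‖ ≤ 2) : Integrable (fun z : ℂ => φ z * (z - ζ)⁻¹) dA :=
  (inv_int ζ hζ).bdd_mul hφ (Filter.Eventually.of_forall hB)

lemma T_bound (φ : ℂ → ℂ) (B : ℝ) (hB : ∀ z, ‖φ z‖ ≤ B)
    (ζ : ℂ) (hζ : ‖ζ‖ ≤ 2) : ‖∫ z, φ z * (z - ζ)⁻¹ ∂dA‖ ≤ B * (1 + CC) := by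
  have hB0 : 0 ≤ B := (norm_nonneg _).trans (hB 0)
  have hI := (integrable_const (μ := dA) (1:ℝ)).add (kk_dA ζ hζ).1
  calc _ ≤ ∫ z, B * (1 + kk (z - ζ)) ∂dA := by
        apply norm_integral_le_of_norm_le (hI.const_mul B)
        refine Filter.Eventually.of_forall fun z => ?_
        rw [norm_mul]
        exact mul_le_mul (hB z) (inv_le_kk _) (norm_nonneg _) hB0
    _ = B * (1 + ∫ z, kk (z - ζ) ∂dA) := by
        rw [integral_const_mul, integral_add (integrable_const _) (kk_dA ζ hζ).1, dA_one]
    _ ≤ _ := by gcongr; exact (kk_dA ζ hζ).2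

lemma ne_ae (ζ : ℂ) : ∀ᵐ z ∂dA, z ≠ ζ := by
  exact dA_abs.ae_le (compl_mem_ae_iff.2 (measure_singleton ζ))

lemma T_holder (φ : ℂ → ℂ) (hφ : AEStronglyMeasurable φ dA) (B : ℝ) (hB : ∀ z, ‖φ z‖ ≤ B)
    (ζ ξ : ℂ) (hζ : ‖ζ‖ ≤ 2) (hξ : ‖ξ‖ ≤ 2) :
    ‖(∫ z, φ z * (z - ζ)⁻¹ ∂dA) - ∫ z, φ z * (z - ξ)⁻¹ ∂dA‖ ≤ B * (√‖ζ - ξ‖ * (2 * CC)) := by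
  have hB0 : 0 ≤ B := (norm_nonneg _).trans (hB 0)
  rw [← integral_sub (phi_int φ hφ B hB ζ hζ) (phi_int φ hφ B hB ξ hξ)]
  have h1 := kk_dA ζ hζ
  have h2 := kk_dA ξ hξ
  calc _ ≤ ∫ z, B * (√‖ζ - ξ‖ * (kk (z - ζ) + kk (z - ξ))) ∂dA := by
        apply norm_integral_le_of_norm_le (((h1.1.add h2.1).const_mul _).const_mul B)
        filter_upwards [ne_ae ζ, ne_ae ξ] with z hz1 hz2
        rw [← mul_sub, norm_mul]
        exact mul_le_mul (hB z) (diff_le_kk _ _ _ hz1 hz2) (norm_nonneg _) hB0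
    _ = B * (√‖ζ - ξ‖ * (∫ z, kk (z - ζ) ∂dA + ∫ z, kk (z - ξ) ∂dA)) := by
        rw [integral_const_mul, integral_const_mul, integral_add h1.1 h2.1]
    _ ≤ _ := by gcongr; linarith [h1.2, h2.2]

lemma P_out (ζ : ℂ) (hζ : 1 < ‖ζ‖) : ∫ z, (z - ζ)⁻¹ ∂dA = -ζ⁻¹ := by
  rw [integral_dA, ← integral_indicator measurableSet_ball, ← Complex.integral_comp_polarCoord_symm]
  have hne : ∀ z : ℂ, ‖z‖ ≤ 1 → z - ζ ≠ 0 := by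
    intro z hz h
    rw [sub_eq_zero.1 h] at hz
    linarith
  set g : ℝ × ℝ → ℂ := fun p => p.1 • (circleMap 0 p.1 p.2 - ζ)⁻¹ with hg
  have hsplit : ∀ p ∈ _root_.polarCoord.target,
      p.1 • (ball (0:ℂ) 1).indicator (fun z => (z - ζ)⁻¹) (Complex.polarCoord.symm p)
      = (Set.Ioo (0:ℝ) 1 ×ˢ Set.Ioo (-Real.pi) Real.pi).indicator g p := by
    rintro ⟨r, θ⟩ hp
    rw [_root_.polarCoord_target] at hp
    obtain ⟨hr, hθ⟩ := hp
    have hr : 0 < r := hr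
    have hs : Complex.polarCoord.symm (r, θ) = circleMap 0 r θ := by
      rw [Complex.polarCoord_symm_apply, circleMap, Complex.exp_mul_I]
      simp
    rw [hs]
    by_cases h1 : r < 1
    · rw [Set.indicator_of_mem, Set.indicator_of_mem]
      · exact ⟨⟨hr, h1⟩, hθ⟩
      · simpa [abs_of_pos hr] using h1
    · rw [Set.indicator_of_notMem, Set.indicator_of_notMem, smul_zero]
      · exact fun h => h1 h.1.2
      · simpa [abs_of_pos hr] using h1
  rw [setIntegral_congr_fun (by
    rw [_root_.polarCoord_target]; exact measurableSet_Ioi.prod measurableSet_Ioo) hsplit,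
    setIntegral_indicator (measurableSet_Ioo.prod measurableSet_Ioo)]
  have hin : _root_.polarCoord.target ∩ (Set.Ioo (0:ℝ) 1 ×ˢ Set.Ioo (-Real.pi) Real.pi)
      = Set.Ioo (0:ℝ) 1 ×ˢ Set.Ioo (-Real.pi) Real.pi := by
    rw [_root_.polarCoord_target]
    apply Set.inter_eq_self_of_subset_right
    exact Set.prod_mono (fun r hr => hr.1) subset_rfl
  rw [hin]
  have hcont : ContinuousOn g (Set.Icc (0:ℝ) 1 ×ˢ Set.Icc (-Real.pi) Real.pi) := by
    have hc : Continuous (fun p : ℝ × ℝ => circleMap 0 p.1 p.2 - ζ) := by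
      unfold circleMap; fun_prop
    refine continuousOn_fst.smul (hc.continuousOn.inv₀ ?_)
    rintro ⟨r, θ⟩ ⟨hr, -⟩
    apply hne
    simp only [norm_circleMap_zero]
    rw [abs_of_nonneg hr.1]; exact hr.2
  have hgInt : IntegrableOn g (Set.Ioo (0:ℝ) 1 ×ˢ Set.Ioo (-Real.pi) Real.pi) (volume.prod volume) := by
    refine (hcont.integrableOn_compact (isCompact_Icc.prod isCompact_Icc)).mono_set ?_
    exact Set.prod_mono Set.Ioo_subset_Icc_self Set.Ioo_subset_Icc_self
  rw [Measure.volume_eq_prod, setIntegral_prod _ hgInt]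
  have hinner : ∀ r ∈ Set.Ioo (0:ℝ) 1, ∫ θ in Set.Ioo (-Real.pi) Real.pi, g (r, θ)
      = r • ((2 * Real.pi) • (-ζ⁻¹)) := by
    intro r hr
    have hd : DiffContOnCl ℂ (fun z : ℂ => (z - ζ)⁻¹) (ball 0 |r|) := by
      have hd' : DifferentiableOn ℂ (fun z : ℂ => (z - ζ)⁻¹) (closedBall 0 |r|) := by
        intro z hz
        have : z - ζ ≠ 0 := by
          apply hne
          rw [mem_closedBall_zero_iff, abs_of_pos hr.1] at hz
          linarith [hr.2]
        exact (by fun_prop (disch := assumption) : DifferentiableAt ℂ (fun z : ℂ => (z - ζ)⁻¹) z).differentiableWithinAt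
      exact hd'.diffContOnCl_ball subset_rfl
    have hm := hd.circleAverage
    rw [Real.circleAverage_def] at hm
    simp only [hg]
    rw [integral_smul, ← integral_Ioc_eq_integral_Ioo, 
      ← intervalIntegral.integral_of_le (by linarith [Real.pi_pos])]
    congr 1
    have hper : Function.Periodic (fun θ => (circleMap 0 r θ - ζ)⁻¹) (2 * Real.pi) := by
      intro θ
      simp only [periodic_circleMap 0 r θ]
    have h5 := hper.intervalIntegral_add_eq (-Real.pi) 0
    rw [show -Real.pi + 2 * Real.pi = Real.pi by ring, zero_add] at h5
    rw [h5]
    simp only [zero_sub, inv_neg] at hm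
    rw [← hm, smul_smul, mul_inv_cancel₀ (by positivity), one_smul]
  rw [setIntegral_congr_fun measurableSet_Ioo hinner, integral_smul_const,
    ← integral_Ioc_eq_integral_Ioo, ← intervalIntegral.integral_of_le zero_le_one, integral_id,
    smul_smul, smul_smul]
  have : 1 / Real.pi * ((1 ^ 2 - 0 ^ 2) / 2) * (2 * Real.pi) = 1 := by
    have := Real.pi_ne_zero
    field_simp
    norm_num
  rw [this, one_smul]

lemma K_diff (φ : ℂ → ℂ) (hφ : AEStronglyMeasurable φ dA) (B : ℝ) (hB : ∀ z, ‖φ z‖ ≤ B)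
    (a : ℂ) (ha : ‖a‖ < 1) (r : ℝ) (hr : 0 < r) (h0 : ∀ z ∈ ball a r, φ z = 0) :
    DifferentiableAt ℂ (fun ζ => ∫ z, φ z * (z - ζ)⁻¹ ∂dA) a := by
  have hB0 : 0 ≤ B := (norm_nonneg _).trans (hB 0)
  have h := hasDerivAt_integral_of_dominated_loc_of_deriv_le (𝕜 := ℂ) (μ := dA) (x₀ := a)
    (F := fun ζ z => φ z * (z - ζ)⁻¹) (F' := fun ζ z => φ z * ((z - ζ)⁻¹ ^ 2))
    (s := ball a (r/2)) (bound := fun _ => B * ((r/2)⁻¹ ^ 2))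
    (ball_mem_nhds a (by positivity))
    (Filter.Eventually.of_forall fun ζ => hφ.mul (inv_meas ζ).aestronglyMeasurable)
    (phi_int φ hφ B hB a (by linarith))
    (hφ.mul ((inv_meas a).pow_const 2).aestronglyMeasurable)
    (Filter.Eventually.of_forall fun z ζ hζ => ?_)
    (integrable_const _)
    (Filter.Eventually.of_forall fun z ζ hζ => ?_)
  · exact h.2.differentiableAt
  · by_cases hz : z ∈ ball a r
    · simp only [h0 z hz, zero_mul, norm_zero]; positivity
    · have h1 : r ≤ dist z a := by simpa using hz
      have h2 : dist ζ a < r / 2 := hζ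
      have h3 : r / 2 ≤ ‖z - ζ‖ := by
        rw [← dist_eq_norm]; linarith [dist_triangle z ζ a]
      rw [norm_mul, norm_pow, norm_inv]
      gcongr
      exact hB z
  · by_cases hz : z ∈ ball a r
    · simp only [h0 z hz, zero_mul]; exact hasDerivAt_const _ _
    · have h1 : r ≤ dist z a := by simpa using hz
      have h2 : dist ζ a < r / 2 := hζ
      have h3 : z - ζ ≠ 0 := by
        intro h
        rw [sub_eq_zero.1 h] at h1
        linarith
      have h4 : HasDerivAt (fun ζ => z - ζ) (-1) ζ := by
        simpa using (hasDerivAt_id ζ).const_sub z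
      have h5 := (h4.inv h3).const_mul (φ z)
      refine h5.congr_deriv ?_
      rw [neg_neg, one_div, inv_pow]

lemma CC_nonneg : 0 ≤ CC :=
  (integral_nonneg (fun z => kk_nonneg _)).trans (kk_dA 0 (by simp)).2

set_option maxHeartbeats 1000000 in
lemma core (σ : ℂ → ℝ) (hσm : AEStronglyMeasurable σ dA) (hσ1 : ∀ z, |σ z| ≤ 1)
    (horth : ∀ v : ℂ → ℝ, MemL1h v → ∫ z, σ z * v z ∂dA = 0)
    (F : ℂ → ℂ) (hF : AnalyticOnNhd ℂ F (ball 0 1)) (M : ℝ)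
    (hM : ∀ z ∈ ball (0:ℂ) 1, |(F z).re| ≤ M)
    (hloc : ∀ a ∈ ball (0:ℂ) 1, (F a).re ≠ 0 → |σ a| = 1 ∧ ∀ᶠ z in nhds a, σ z = σ a)
    (z0 : ℂ) (hz0 : z0 ∈ ball (0:ℂ) 1) (h0 : (F z0).re ≠ 0) : False := by
  have hCC := CC_nonneg
  set τ : ℂ → ℂ := fun z => (σ z : ℂ) with hτ
  have hτm : AEStronglyMeasurable τ dA := Complex.continuous_ofReal.comp_aestronglyMeasurable hσm
  have hτ1 : ∀ z, ‖τ z‖ ≤ 1 := fun z => by simpa [hτ] using hσ1 z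
  set T : ℂ → ℂ := fun ζ => ∫ z, τ z * (z - ζ)⁻¹ ∂dA with hT
  set P : ℂ → ℂ := fun ζ => ∫ z, 1 * (z - ζ)⁻¹ ∂dA with hP
  have hTout : ∀ ζ : ℂ, 1 < ‖ζ‖ → ‖ζ‖ ≤ 2 → T ζ = 0 := by
    intro ζ h1 h2
    have han : ∀ z ∈ ball (0:ℂ) 1, AnalyticAt ℂ (fun z : ℂ => (z - ζ)⁻¹) z := by
      intro z hz
      have : z - ζ ≠ 0 := by
        intro h
        rw [sub_eq_zero.1 h, mem_ball_zero_iff] at hz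
        linarith
      fun_prop (disch := assumption)
    have hi := inv_int ζ h2
    have hre := horth (fun z => ((z - ζ)⁻¹).re)
      ⟨(harmonicOnR_iff _).2 fun z hz => (han z hz).harmonicAt_re, hi.re⟩
    have him := horth (fun z => ((z - ζ)⁻¹).im)
      ⟨(harmonicOnR_iff _).2 fun z hz => (han z hz).harmonicAt_im, hi.im⟩
    have hti := phi_int τ hτm 1 hτ1 ζ h2
    have e1 : (T ζ).re = ∫ z, (τ z * (z - ζ)⁻¹).re ∂dA := (integral_re hti).symm
    have e2 : (T ζ).im = ∫ z, (τ z * (z - ζ)⁻¹).im ∂dA := (integral_im hti).symm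
    apply Complex.ext
    · rw [e1, Complex.zero_re, ← hre]
      congr 1; ext z; simp only [hτ, Complex.re_ofReal_mul]
    · rw [e2, Complex.zero_im, ← him]
      congr 1; ext z; simp only [hτ, Complex.im_ofReal_mul]
  have hPout : ∀ ζ : ℂ, 1 < ‖ζ‖ → P ζ = -ζ⁻¹ := by
    intro ζ h; simp only [hP, one_mul]; exact P_out ζ h
  set K : ℂ → ℂ → ℂ := fun s ζ => ∫ z, (τ z - s) * (z - ζ)⁻¹ ∂dA with hK
  have hφm : ∀ s : ℂ, AEStronglyMeasurable (fun z => τ z - s) dA := fun s =>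
    hτm.sub aestronglyMeasurable_const
  have hφ1 : ∀ s : ℂ, ‖s‖ ≤ 1 → ∀ z, ‖τ z - s‖ ≤ 2 := fun s hs z =>
    (norm_sub_le _ _).trans (by linarith [hτ1 z])
  have hKTP : ∀ s ζ : ℂ, ‖ζ‖ ≤ 2 → K s ζ = T ζ - s * P ζ := by
    intro s ζ h
    simp only [hK, hT, hP, sub_mul]
    rw [integral_sub (phi_int τ hτm 1 hτ1 ζ h) ((inv_int ζ h).const_mul s), integral_const_mul]
    simp
  have hKb : ∀ s ζ : ℂ, ‖s‖ ≤ 1 → ‖ζ‖ ≤ 2 → ‖K s ζ‖ ≤ 2 * (1 + CC) := fun s ζ hs hζ =>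
    T_bound _ 2 (hφ1 s hs) ζ hζ
  set G : ℂ → ℂ := fun ζ => ζ * K (τ ζ) ζ - τ ζ with hG
  have hGd : ∀ a ∈ ball (0:ℂ) 1, (F a).re ≠ 0 → DifferentiableAt ℂ G a := by
    intro a ha hne
    have hev := (hloc a ha hne).2
    obtain ⟨r, hr, hball⟩ := Metric.eventually_nhds_iff_ball.1 hev
    have hd : DifferentiableAt ℂ (K (τ a)) a := K_diff (fun z => τ z - τ a) (hφm _) 2
      (hφ1 _ (hτ1 a)) a (by simpa using ha) r hr (fun z hz => by simp [hτ, hball z hz])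
    have hEq : G =ᶠ[nhds a] fun ζ => ζ * K (τ a) ζ - τ a := by
      filter_upwards [hev] with ζ hζ
      have : τ ζ = τ a := by simp only [hτ, hζ]
      simp only [hG, this]
    exact (by fun_prop : DifferentiableAt ℂ (fun ζ => ζ * K (τ a) ζ - τ a) a).congr_of_eventuallyEq hEq
  have hGC : ∀ z ∈ ball (0:ℂ) 1, ‖G z‖ ≤ 2 * (1 + CC) + 1 := by
    intro z hz
    rw [mem_ball_zero_iff] at hz
    refine (norm_sub_le _ _).trans (add_le_add ?_ (hτ1 z))
    rw [norm_mul]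
    have := hKb (τ z) z (hτ1 z) (by linarith)
    nlinarith [norm_nonneg z, norm_nonneg (K (τ z) z)]
  have hGb : ∀ δ > 0, ∃ r < 1, ∀ z : ℂ, r ≤ ‖z‖ → ‖z‖ < 1 → ‖G z‖ ≤ δ := by
    intro δ hδ
    set E := 8 * CC + 2 with hE
    have hE0 : 0 < E := by positivity
    refine ⟨max (1/2) (1 - (δ / E)^2), max_lt (by norm_num) (by
      have : 0 < (δ / E)^2 := by positivity
      linarith), fun z hz1 hz2 => ?_⟩
    set ρ := ‖z‖ with hρ
    have hρ1 : 1/2 ≤ ρ := (le_max_left _ _).trans hz1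
    have hρ2 : 1 - (δ / E)^2 ≤ ρ := (le_max_right _ _).trans hz1
    have hρ0 : 0 < ρ := by linarith
    have hz : z ≠ 0 := norm_pos_iff.1 hρ0
    set ξ : ℂ := ((ρ^2)⁻¹ : ℝ) * z with hξ
    have hξn : ‖ξ‖ = ρ⁻¹ := by
      rw [hξ, norm_mul, Complex.norm_real, Real.norm_of_nonneg (by positivity), ← hρ]
      field_simp
    have hξ1 : 1 < ‖ξ‖ := by rw [hξn]; exact (one_lt_inv₀ hρ0).2 hz2
    have hξ2 : ‖ξ‖ ≤ 2 := by
      rw [hξn]; exact inv_le_of_inv_le₀ (by norm_num) (by linarith)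
    have hdist : ‖z - ξ‖ ≤ 4 * (1 - ρ) := by
      have : z - ξ = ((1 - (ρ^2)⁻¹ : ℝ) : ℂ) * z := by rw [hξ]; push_cast; ring
      have h1 : 1 ≤ (ρ^2)⁻¹ := (one_le_inv₀ (by positivity)).2 (by nlinarith)
      rw [this, norm_mul, Complex.norm_real, Real.norm_of_nonpos (by linarith), ← hρ]
      have : -(1 - (ρ ^ 2)⁻¹) * ρ = (1 - ρ) * (1 + ρ) * ρ⁻¹ := by
        field_simp; ring
      rw [this]
      have h2 : ρ⁻¹ ≤ 2 := by rw [← hξn]; exact hξ2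
      have h3 : (1 + ρ) * ρ⁻¹ ≤ 4 := by
        calc (1 + ρ) * ρ⁻¹ ≤ 2 * 2 := by gcongr; linarith
          _ = 4 := by norm_num
      nlinarith
    set η := √(1 - ρ) with hη
    have hη2 : η ^ 2 = 1 - ρ := Real.sq_sqrt (by linarith)
    have hη0 : 0 ≤ η := Real.sqrt_nonneg _
    have hη1 : η ≤ 1 := by rw [hη]; exact Real.sqrt_le_one.2 (by linarith)
    have hηδ : η ≤ δ / E := by
      apply Real.sqrt_le_iff.2
      exact ⟨by positivity, by linarith⟩
    have hsq : √‖z - ξ‖ ≤ 2 * η := by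
      apply Real.sqrt_le_iff.2
      exact ⟨by positivity, by nlinarith⟩
    have hTd := T_holder τ hτm 1 hτ1 z ξ (by linarith) hξ2
    have hPd := T_holder (fun _ => 1) aestronglyMeasurable_const 1 (by simp) z ξ (by linarith) hξ2
    change ‖T z - T ξ‖ ≤ _ at hTd
    change ‖P z - P ξ‖ ≤ _ at hPd
    have hzP : z * P ξ = -((ρ ^ 2 : ℝ) : ℂ) := by
      rw [hPout ξ hξ1, hξ]
      have : (ρ : ℂ) ≠ 0 := by exact_mod_cast hρ0.ne'
      push_cast
      field_simp
    have hGe : G z = z * (T z - T ξ) - τ z * (z * (P z - P ξ)) - τ z * ((1 - ρ^2 : ℝ) : ℂ) := by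
      simp only [hG]
      rw [hKTP _ _ (by linarith), hTout ξ hξ1 hξ2]
      push_cast at hzP ⊢
      linear_combination -τ z * hzP
    have hb : √‖z - ξ‖ * (2 * CC) ≤ 4 * CC * η := by nlinarith
    have n1 : ‖z * (T z - T ξ)‖ ≤ 4 * CC * η := by
      rw [norm_mul]; nlinarith [norm_nonneg (T z - T ξ)]
    have n2 : ‖τ z * (z * (P z - P ξ))‖ ≤ 4 * CC * η := by
      rw [norm_mul, norm_mul]
      have : ‖z‖ * ‖P z - P ξ‖ ≤ 4 * CC * η := by nlinarith [norm_nonneg (P z - P ξ)]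
      have h0 : 0 ≤ ‖z‖ * ‖P z - P ξ‖ := by positivity
      nlinarith [hτ1 z, norm_nonneg (τ z)]
    have n3 : ‖τ z * ((1 - ρ^2 : ℝ) : ℂ)‖ ≤ 2 * η := by
      have h1 : 1 - ρ^2 ≤ 2 * η := by nlinarith
      have h2 : 0 ≤ 1 - ρ^2 := by nlinarith
      rw [norm_mul, Complex.norm_real (1 - ρ^2), Real.norm_of_nonneg h2]
      nlinarith [hτ1 z, norm_nonneg (τ z)]
    calc ‖G z‖ ≤ 4 * CC * η + 4 * CC * η + 2 * η := by
          rw [hGe]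
          exact (norm_sub_le _ _).trans (add_le_add ((norm_sub_le _ _).trans (add_le_add n1 n2)) n3)
      _ = E * η := by rw [hE]; ring
      _ ≤ E * (δ / E) := by gcongr
      _ = δ := by field_simp
  have hGz : ∀ z ∈ ball (0:ℂ) 1, (F z).re ≠ 0 → G z = 0 := by
    intro z hz hne
    rcases lt_or_gt_of_ne hne with h | h
    · apply maxprin G (fun w => -F w) _ M hF.neg
        (fun w hw hp => hGd w hw (by simp at hp; exact hp.ne)) hGC
        (fun w hw => by simpa using (abs_le.1 (hM w hw)).1 |> neg_le.1) hGb z hz (by simpa using h)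
    · exact maxprin G F _ M hF (fun w hw hp => hGd w hw hp.ne') hGC
        (fun w hw => (abs_le.1 (hM w hw)).2) hGb z hz h
  -- a point near the origin
  obtain ⟨ζ, hζ1, hζ2, hζ3⟩ : ∃ ζ : ℂ, ‖ζ‖ < 1 ∧ ‖ζ‖ * (2 * (1 + CC)) < 1 ∧ (F ζ).re ≠ 0 := by
    by_contra! hcon
    set r := (2 * (1 + CC))⁻¹ with hr
    have hr0 : 0 < r := by positivity
    have hsub : ball (0:ℂ) (min 1 r) ⊆ {z | z ∈ ball (0:ℂ) 1 ∧ (F z).re = 0} := by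
      intro z hz
      rw [mem_ball_zero_iff, lt_min_iff] at hz
      refine ⟨by simpa using hz.1, hcon z hz.1 ?_⟩
      calc ‖z‖ * (2 * (1 + CC)) < r * (2 * (1 + CC)) := by gcongr; exact hz.2
        _ = 1 := by rw [hr]; field_simp
    have h1 := measure_mono_null hsub (null_zero F hF z0 hz0 h0)
    exact (measure_ball_pos volume (0:ℂ) (lt_min one_pos hr0)).ne' h1
  have hζb : ζ ∈ ball (0:ℂ) 1 := by simpa using hζ1
  have h1 := hGz ζ hζb hζ3
  have h2 : ζ * K (τ ζ) ζ = τ ζ := sub_eq_zero.1 h1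
  have h3 : ‖τ ζ‖ = 1 := by simpa [hτ] using (hloc ζ hζb hζ3).1
  have h4 := hKb (τ ζ) ζ (hτ1 ζ) (by linarith)
  rw [← h2, norm_mul] at h3
  nlinarith [norm_nonneg ζ]

lemma sgn_meas (g : ℂ → ℝ) (hg : Integrable g dA) :
    AEStronglyMeasurable (fun z => ((SignType.sign (g z) : SignType) : ℝ)) dA := by
  have hm : Measurable (fun x : ℝ => ((SignType.sign x : SignType) : ℝ)) := by
    have : (fun x : ℝ => ((SignType.sign x : SignType) : ℝ)) =
        fun x => if 0 < x then 1 else if x < 0 then -1 else 0 := by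
      ext x
      rw [sign_apply]
      split_ifs <;> simp
    rw [this]
    refine Measurable.ite measurableSet_Ioi measurable_const
      (Measurable.ite measurableSet_Iio measurable_const measurable_const)
  exact (hm.comp_aemeasurable hg.aemeasurable).aestronglyMeasurable

lemma orth (g : ℂ → ℝ) (hg : Integrable g dA) (hne : ∀ᵐ z ∂dA, g z ≠ 0)
    (v : ℂ → ℝ) (hv : Integrable v dA)
    (hmin : ∀ t : ℝ, ∫ z, |g z| ∂dA ≤ ∫ z, |g z - t * v z| ∂dA) :
    ∫ z, ((SignType.sign (g z) : SignType) : ℝ) * v z ∂dA = 0 := by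
  have hsm := sgn_meas g hg
  have h := hasDerivAt_integral_of_dominated_loc_of_lip (𝕜 := ℝ) (μ := dA) (x₀ := (0:ℝ))
    (F := fun t z => |g z - t * v z|)
    (F' := fun z => ((SignType.sign (g z) : SignType) : ℝ) * (-v z))
    (s := Set.univ) (bound := fun z => |v z|) Filter.univ_mem
    (Filter.Eventually.of_forall fun t => (hg.sub (hv.const_mul t)).abs.aestronglyMeasurable)
    (by simpa using hg.abs)
    (hsm.mul hv.neg.aestronglyMeasurable)
    (Filter.Eventually.of_forall fun z => ?_)
    hv.abs
    ?_
  · have hloc : IsLocalMin (fun t : ℝ => ∫ z, |g z - t * v z| ∂dA) 0 := by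
      refine Filter.Eventually.of_forall fun t => ?_
      simpa using hmin t
    have h0 := hloc.hasDerivAt_eq_zero h.2
    simp only [mul_neg] at h0
    rw [integral_neg] at h0
    linarith
  · refine LipschitzOnWith.of_dist_le_mul fun t _ s _ => ?_
    rw [Real.dist_eq, Real.dist_eq]
    refine (abs_abs_sub_abs_le_abs_sub _ _).trans ?_
    rw [show g z - t * v z - (g z - s * v z) = - (v z * (t - s)) by ring, abs_neg, abs_mul]
    simp
  · filter_upwards [hne] with z hz
    have h1 : HasDerivAt (fun t : ℝ => g z - t * v z) (-v z) 0 := by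
      simpa using ((hasDerivAt_id (0:ℝ)).mul_const (v z)).const_sub (g z)
    have h2 : HasDerivAt (fun x : ℝ => |x|) ((SignType.sign (g z) : SignType) : ℝ) (g z - 0 * v z) := by
      rw [zero_mul, sub_zero]
      exact hasDerivAt_abs hz
    exact h2.comp (0:ℝ) h1

theorem stmt_6 (ω h₁ h₂ : ℂ → ℝ)
    (hωc : ContinuousOn ω (ball (0 : ℂ) 1)) (hωi : Integrable ω dA)
    (hm₁ : MemL1h h₁) (hm₂ : MemL1h h₂)
    (hb₁ : ∀ u : ℂ → ℝ, MemL1h u →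
      (∫ z, |ω z - h₁ z| ∂dA) ≤ ∫ z, |ω z - u z| ∂dA)
    (hb₂ : ∀ u : ℂ → ℝ, MemL1h u →
      (∫ z, |ω z - h₂ z| ∂dA) ≤ ∫ z, |ω z - u z| ∂dA)
    (hbdd : ∃ M : ℝ, ∀ z ∈ ball (0 : ℂ) 1, |h₁ z - h₂ z| ≤ M) :
    Set.EqOn h₁ h₂ (ball (0 : ℂ) 1) := by
  intro z0 hz0
  by_contra hne
  obtain ⟨M, hM⟩ := hbdd
  have hh1 := (harmonicOnR_iff h₁).1 hm₁.1
  have hh2 := (harmonicOnR_iff h₂).1 hm₂.1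
  have hc1 := hh1.continuousOn
  have hc2 := hh2.continuousOn
  obtain ⟨F, hF, hFre⟩ := (hh1.sub hh2).exists_analyticOnNhd_ball_re_eq
  have hFre' : ∀ z ∈ ball (0:ℂ) 1, (F z).re = h₁ z - h₂ z := fun z hz => hFre hz
  have h0 : (F z0).re ≠ 0 := by rw [hFre' z0 hz0]; exact sub_ne_zero.2 hne
  -- the midpoint
  set h : ℂ → ℝ := (1/2 : ℝ) • (h₁ + h₂) with hh
  have hhv : ∀ z, h z = (h₁ z + h₂ z) / 2 := fun z => by simp [hh]; ring
  have hhH := (hh1.add hh2).const_smul (c := (1/2 : ℝ))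
  have hhi : Integrable h dA := (hm₁.2.add hm₂.2).smul (1/2 : ℝ)
  set g : ℂ → ℝ := fun z => ω z - h z with hg
  have hgi : Integrable g dA := hωi.sub hhi
  have hgc : ContinuousOn g (ball (0:ℂ) 1) := hωc.sub hhH.continuousOn
  have ha : Integrable (fun z => |ω z - h₁ z|) dA := (hωi.sub hm₁.2).abs
  have hb : Integrable (fun z => |ω z - h₂ z|) dA := (hωi.sub hm₂.2).abs
  have hd : ∀ z, |g z| ≤ (|ω z - h₁ z| + |ω z - h₂ z|) / 2 := by
    intro z
    have : g z = ((ω z - h₁ z) + (ω z - h₂ z)) / 2 := by simp only [hg, hhv]; ring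
    rw [this, abs_div, abs_two]
    gcongr
    exact abs_add_le _ _
  have e12 : ∫ z, |ω z - h₁ z| ∂dA = ∫ z, |ω z - h₂ z| ∂dA :=
    le_antisymm (hb₁ h₂ hm₂) (hb₂ h₁ hm₁)
  have hsi : Integrable (fun z => (|ω z - h₁ z| + |ω z - h₂ z|) / 2) dA := (ha.add hb).div_const 2
  have hIs : ∫ z, (|ω z - h₁ z| + |ω z - h₂ z|) / 2 ∂dA = ∫ z, |ω z - h₁ z| ∂dA := by
    rw [integral_div, integral_add ha hb, ← e12]; ring
  have hmid : ∀ u, MemL1h u → ∫ z, |g z| ∂dA ≤ ∫ z, |ω z - u z| ∂dA := by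
    intro u hu
    calc _ ≤ _ := integral_mono hgi.abs hsi hd
      _ = _ := hIs
      _ ≤ _ := hb₁ u hu
  have hae : ∀ᵐ z ∂dA, (|ω z - h₁ z| + |ω z - h₂ z|) / 2 - |g z| = 0 := by
    have hnn : 0 ≤ fun z => (|ω z - h₁ z| + |ω z - h₂ z|) / 2 - |g z| := fun z => sub_nonneg.2 (hd z)
    refine (integral_eq_zero_iff_of_nonneg hnn (hsi.sub hgi.abs)).1 ?_
    apply le_antisymm _ (integral_nonneg hnn)
    rw [integral_sub hsi hgi.abs, hIs]
    have := hb₁ h ⟨(harmonicOnR_iff _).2 hhH, hhi⟩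
    linarith
  have heq : ∀ z ∈ ball (0:ℂ) 1, (|ω z - h₁ z| + |ω z - h₂ z|) / 2 - |g z| = 0 := by
    have hae' : (fun z => (|ω z - h₁ z| + |ω z - h₂ z|) / 2 - |g z|)
        =ᵐ[(volume : Measure ℂ).restrict (ball 0 1)] fun _ => 0 := by
      have hp : ENNReal.ofReal (1 / Real.pi) ≠ 0 := by
        simp [Real.pi_pos]
      unfold dA at hae
      rw [ae_iff, Measure.smul_apply, smul_eq_mul, mul_eq_zero] at hae
      exact ae_iff.2 (hae.resolve_left hp)
    refine Measure.eqOn_open_of_ae_eq hae' isOpen_ball ?_ continuousOn_const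
    exact (((hωc.sub hc1).abs.add (hωc.sub hc2).abs).div_const 2).sub hgc.abs
  have hgu : ∀ z ∈ ball (0:ℂ) 1, (F z).re ≠ 0 → g z ≠ 0 := by
    intro z hz hz1 hz2
    have h3 := heq z hz
    rw [hz2, abs_zero, sub_zero] at h3
    have p1 := abs_nonneg (ω z - h₁ z)
    have p2 := abs_nonneg (ω z - h₂ z)
    have q1 : ω z - h₁ z = 0 := abs_eq_zero.1 (by linarith)
    have q2 : ω z - h₂ z = 0 := abs_eq_zero.1 (by linarith)
    apply hz1
    rw [hFre' z hz]; linarith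
  have hgne : ∀ᵐ z ∂dA, g z ≠ 0 := by
    have hn := null_zero F hF z0 hz0 h0
    have h1 : ∀ᵐ z ∂dA, ¬ (z ∈ ball (0:ℂ) 1 ∧ (F z).re = 0) := 
      dA_abs.ae_le (compl_mem_ae_iff.2 hn)
    filter_upwards [h1, ae_dA (p := fun z => z ∈ ball (0:ℂ) 1) (fun z hz => hz)] with z hz1 hz2
    exact hgu z hz2 fun h => hz1 ⟨hz2, h⟩
  set σ : ℂ → ℝ := fun z => ((SignType.sign (g z) : SignType) : ℝ) with hσ
  have hsm : AEStronglyMeasurable σ dA := sgn_meas g hgi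
  refine core σ hsm ?_ ?_ F hF M ?_ ?_ z0 hz0 h0
  · intro z
    simp only [hσ]
    rcases SignType.trichotomy (SignType.sign (g z)) with h | h | h <;> simp [h]
  · intro v hv
    apply orth g hgi hgne v hv.2
    intro t
    have hvH := (harmonicOnR_iff v).1 hv.1
    have := hmid (h + t • v) ⟨(harmonicOnR_iff _).2 (hhH.add (hvH.const_smul (c := t))),
      hhi.add (hv.2.smul t)⟩
    refine this.trans (le_of_eq ?_)
    congr 1; ext z
    simp only [hg, Pi.add_apply, Pi.smul_apply, smul_eq_mul]
    congr 1; ring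
  · intro z hz
    rw [hFre' z hz]; exact hM z hz
  · intro a ha hne
    have hga := hgu a ha hne
    have hgca : ContinuousAt g a := hgc.continuousAt (isOpen_ball.mem_nhds ha)
    rcases lt_or_gt_of_ne hga with h | h
    · refine ⟨by simp [hσ, sign_neg h], ?_⟩
      filter_upwards [hgca.eventually_lt_const h] with z hz
      simp [hσ, sign_neg h, sign_neg hz]
    · refine ⟨by simp [hσ, sign_pos h], ?_⟩
      filter_upwards [hgca.eventually_const_lt h] with z hz
      simp [hσ, sign_pos h, sign_pos hz]
end

section
/- Let G be a bounded domain in ℝ^n and let F ⊆ G be a measurable set satisfying ∫_F dist(x, ∂G)^{−n} dx < ∞. Then F is not a weak peak set for L^1_h(G): there is a constant M such that ∫_F |h| dx ≤ M ∫_{G∖F} |h| dx for all h ∈ L^1_h(G), i.e. A(F) < ∞. -/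
open MeasureTheory Metric
open scoped ENNReal

/-- The Laplacian of `f : ℝⁿ → ℝ`, computed via second derivatives in the coordinate
directions. -/
noncomputable def lap {n : ℕ} (f : EuclideanSpace ℝ (Fin n) → ℝ)
    (x : EuclideanSpace ℝ (Fin n)) : ℝ :=
  ∑ j : Fin n, fderiv ℝ (fun y => fderiv ℝ f y (EuclideanSpace.single j 1)) x
    (EuclideanSpace.single j 1)

/-- `f` is harmonic on `U`: twice continuously differentiable with vanishing Laplacian. -/
def HarmonicOn {n : ℕ} (f : EuclideanSpace ℝ (Fin n) → ℝ)
    (U : Set (EuclideanSpace ℝ (Fin n))) : Prop :=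
  ContDiffOn ℝ 2 f U ∧ ∀ x ∈ U, lap f x = 0


section PeakAux


open Set Filter Topology
open scoped ContDiff

/-- the radial kernel data -/
structure PeakKernel (n : ℕ) (P ψ : EuclideanSpace ℝ (Fin n) → ℝ) : Prop where
  smoothP : ContDiff ℝ ∞ P
  smooth : ContDiff ℝ ∞ ψ
  suppP : ∀ y, 1 < ‖y‖ → P y = 0
  supp : ∀ y, 1 < ‖y‖ → ψ y = 0
  grad : ∀ y v, fderiv ℝ P y v = ψ y * inner ℝ y v
  int : ∫ y, ψ y = 1

theorem PeakKernel.compact_of_supp {n : ℕ} {f : EuclideanSpace ℝ (Fin n) → ℝ}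
    (hf : ∀ y, 1 < ‖y‖ → f y = 0) : HasCompactSupport f := by
  refine HasCompactSupport.intro (isCompact_closedBall (0 : EuclideanSpace ℝ (Fin n)) 1) ?_
  intro x hx
  apply hf
  simpa using hx

theorem exists_peakKernel (n : ℕ) : ∃ P ψ : EuclideanSpace ℝ (Fin n) → ℝ, PeakKernel n P ψ := by
  let E := EuclideanSpace ℝ (Fin n)
  let g : ℝ → ℝ := fun s => (s⁻¹) ^ 2 * expNegInvGlue s
  have hg : ContDiff ℝ ∞ g := by
    have := expNegInvGlue.contDiff_polynomial_eval_inv_mul (n := ⊤) (Polynomial.X ^ 2)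
    simpa [g] using this
  have hd : ∀ s, HasDerivAt expNegInvGlue (g s) s := by
    intro s
    have := expNegInvGlue.hasDerivAt_polynomial_eval_inv_mul 1 s
    simpa [g] using this
  have hg0 : ∀ s, 0 ≤ g s := fun s => mul_nonneg (sq_nonneg _) (expNegInvGlue.nonneg s)
  let ψ₀ : E → ℝ := fun y => g (1 - ‖y‖ ^ 2)
  let P₀ : E → ℝ := fun y => - (1/2) * expNegInvGlue (1 - ‖y‖ ^ 2)
  have hns : ContDiff ℝ ∞ (fun y : E => 1 - ‖y‖ ^ 2) := contDiff_const.sub (contDiff_norm_sq ℝ)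
  have hψ : ContDiff ℝ ∞ ψ₀ := hg.comp hns
  have hP : ContDiff ℝ ∞ P₀ := contDiff_const.mul (expNegInvGlue.contDiff.comp hns)
  have hz : ∀ y : E, 1 < ‖y‖ → expNegInvGlue (1 - ‖y‖ ^ 2) = 0 := by
    intro y hy
    apply expNegInvGlue.zero_of_nonpos
    nlinarith
  have hψs : ∀ y : E, 1 < ‖y‖ → ψ₀ y = 0 := by
    intro y hy
    simp [ψ₀, g, hz y hy]
  have hPs : ∀ y : E, 1 < ‖y‖ → P₀ y = 0 := by
    intro y hy
    simp [P₀, hz y hy]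
  have hgrad : ∀ y v, fderiv ℝ P₀ y v = ψ₀ y * inner ℝ y v := by
    intro y v
    have h1 : HasFDerivAt (fun y : E => 1 - ‖y‖ ^ 2) (-(2 • (innerSL ℝ y))) y := by
      have := (hasStrictFDerivAt_norm_sq y).hasFDerivAt.const_sub 1
      simpa using this
    have h2 := ((hd (1 - ‖y‖ ^ 2)).comp_hasFDerivAt y h1).const_mul (-(1/2) : ℝ)
    have h3 : fderiv ℝ P₀ y = _ := h2.fderiv
    rw [h3]
    simp [ψ₀]
    ring
  have hpos : 0 < ∫ y, ψ₀ y := by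
    refine hψ.continuous.integral_pos_of_hasCompactSupport_nonneg_nonzero
      (PeakKernel.compact_of_supp hψs) (fun y => hg0 _) (x := 0) ?_
    have := expNegInvGlue.pos_of_pos (x := 1) one_pos
    simp [ψ₀, g, this.ne']
  refine ⟨fun y => (∫ y, ψ₀ y)⁻¹ * P₀ y, fun y => (∫ y, ψ₀ y)⁻¹ * ψ₀ y, ?_⟩
  constructor
  · exact contDiff_const.mul hP
  · exact contDiff_const.mul hψ
  · intro y hy; simp [hPs y hy]
  · intro y hy; simp [hψs y hy]
  · intro y v
    have := ((hP.differentiable (by simp)) y).hasFDerivAt.const_mul ((∫ y, ψ₀ y)⁻¹)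
    rw [this.fderiv]
    simp [hgrad]
    ring
  · rw [integral_const_mul, inv_mul_cancel₀ hpos.ne']

/-- cutoff -/
theorem exists_cutoff {n : ℕ} {G : Set (EuclideanSpace ℝ (Fin n))} (hG : IsOpen G)
    {f : EuclideanSpace ℝ (Fin n) → ℝ} {k : ℕ∞} (hf : ContDiffOn ℝ k f G)
    {x : EuclideanSpace ℝ (Fin n)} {r : ℝ} (hr : 0 < r) (hx : closedBall x r ⊆ G) :
    ∃ F : EuclideanSpace ℝ (Fin n) → ℝ, ContDiff ℝ k F ∧ HasCompactSupport F ∧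
      ∃ δ > 0, ball x (r + δ) ⊆ G ∧ ∀ y ∈ ball x (r + δ), F y = f y := by
  obtain ⟨δ, hδ, h⟩ := (isCompact_closedBall x r).exists_cthickening_subset_open hG hx
  rw [cthickening_closedBall hδ.le hr.le] at h
  let χ : ContDiffBump x := ⟨r + δ/2, r + δ, by positivity, by linarith⟩
  refine ⟨fun y => χ y * f y, ?_, ?_, δ/2, by positivity, ?_, ?_⟩
  · rw [contDiff_iff_contDiffAt]
    intro y
    by_cases hy : y ∈ G
    · exact (χ.contDiff.contDiffAt).mul ((hf y hy).contDiffAt (hG.mem_nhds hy))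
    · have hy' : y ∉ tsupport χ := by
        rw [χ.tsupport_eq]
        intro h'
        exact hy (h (by simpa [add_comm] using h'))
      have : (fun y => χ y * f y) =ᶠ[𝓝 y] fun _ => 0 := by
        have := notMem_tsupport_iff_eventuallyEq.1 hy'
        filter_upwards [this] with z hz
        simp [hz]
      exact contDiffAt_const.congr_of_eventuallyEq this
  · exact χ.hasCompactSupport.mul_right
  · refine (ball_subset_closedBall.trans (closedBall_subset_closedBall ?_)).trans h
    linarith
  · intro y hy
    have : χ y = 1 := χ.one_of_mem_closedBall (ball_subset_closedBall hy)
    simp [this]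

/-- The mean value property in mollified form. -/
def PeakMV {n : ℕ} (ψ : EuclideanSpace ℝ (Fin n) → ℝ) (G : Set (EuclideanSpace ℝ (Fin n)))
    (f : EuclideanSpace ℝ (Fin n) → ℝ) : Prop :=
  ContinuousOn f G ∧ ∀ x r, 0 < r → closedBall x r ⊆ G → f x = ∫ y, ψ y * f (x + r • y)

theorem PeakKernel.integral_congr {n : ℕ} {ψ : EuclideanSpace ℝ (Fin n) → ℝ}
    {f g : EuclideanSpace ℝ (Fin n) → ℝ} (hψ : ∀ y, 1 < ‖y‖ → ψ y = 0)
    {x : EuclideanSpace ℝ (Fin n)} {r : ℝ} (hr : 0 ≤ r) (h : ∀ y ∈ closedBall x r, f y = g y) :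
    ∫ y, ψ y * f (x + r • y) = ∫ y, ψ y * g (x + r • y) := by
  congr 1
  ext y
  by_cases hy : 1 < ‖y‖
  · simp [hψ y hy]
  · rw [h]
    push Not at hy
    simp [norm_smul, abs_of_nonneg hr]
    nlinarith

/-- Differentiating the average. -/
theorem PeakKernel.hasDerivAt_avg {n : ℕ} {P ψ : EuclideanSpace ℝ (Fin n) → ℝ}
    (K : PeakKernel n P ψ) {F : EuclideanSpace ℝ (Fin n) → ℝ} (hF : ContDiff ℝ 1 F)
    (hFc : HasCompactSupport F) (c w : EuclideanSpace ℝ (Fin n) → EuclideanSpace ℝ (Fin n))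
    (hc : Continuous c) (hw : Continuous w) (t₀ : ℝ) :
    HasDerivAt (fun t : ℝ => ∫ y, ψ y * F (c y + t • w y))
      (∫ y, ψ y * fderiv ℝ F (c y + t₀ • w y) (w y)) t₀ := by
  have hF' : Continuous (fderiv ℝ F) := hF.continuous_fderiv (by simp)
  obtain ⟨C, hC⟩ := (hFc.fderiv (𝕜 := ℝ)).exists_bound_of_continuous hF'
  have hψc := compact_of_supp K.supp
  have hψ := K.smooth.continuous
  refine (hasDerivAt_integral_of_dominated_loc_of_deriv_le (F := fun t y => ψ y * F (c y + t • w y))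
    (F' := fun t y => ψ y * fderiv ℝ F (c y + t • w y) (w y))
    (bound := fun y => |ψ y| * (C * ‖w y‖)) univ_mem ?_ ?_ ?_ ?_ ?_ ?_).2
  · refine Eventually.of_forall fun t => Continuous.aestronglyMeasurable ?_
    have := hF.continuous
    fun_prop
  · refine Continuous.integrable_of_hasCompactSupport ?_ hψc.mul_right
    have := hF.continuous
    fun_prop
  · refine Continuous.aestronglyMeasurable ?_
    fun_prop
  · refine Eventually.of_forall fun y t _ => ?_
    rw [norm_mul]
    gcongr
    · exact le_of_eq (Real.norm_eq_abs _)
    · exact (ContinuousLinearMap.le_opNorm _ _).trans (by gcongr; exact hC _)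
  · refine Continuous.integrable_of_hasCompactSupport (by fun_prop) ?_
    exact HasCompactSupport.mul_right (f := fun y => |ψ y|) (hψc.comp_left (g := fun t => |t|) (by simp))
  · refine Eventually.of_forall fun y t _ => ?_
    have h1 : HasDerivAt (fun t : ℝ => c y + t • w y) (w y) t := by
      simpa using ((hasDerivAt_id t).smul_const (w y)).const_add (c y)
    exact ((hF.differentiable (by simp) _).hasFDerivAt.comp_hasDerivAt t h1).const_mul _

theorem HarmonicOn.peakMV {n : ℕ} {P ψ : EuclideanSpace ℝ (Fin n) → ℝ}
    (K : PeakKernel n P ψ) {G : Set (EuclideanSpace ℝ (Fin n))} (hG : IsOpen G)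
    {h : EuclideanSpace ℝ (Fin n) → ℝ} (hh : HarmonicOn h G) : PeakMV ψ G h := by
  refine ⟨hh.1.continuousOn, ?_⟩
  intro x r hr hx
  obtain ⟨F, hF, hFc, δ, hδ, -, hFe⟩ := exists_cutoff hG (k := 2) hh.1 hr hx
  have hin : ∀ y ∈ closedBall x r, y ∈ ball x (r + δ) := fun y hy =>
    closedBall_subset_ball (by linarith) hy
  have hF1 : ContDiff ℝ 1 F := hF.of_le (by norm_num)
  -- Laplacian of F
  have hlap : ∀ y ∈ closedBall x r, lap F y = 0 := by
    intro y hy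
    rw [← hh.2 y (hx hy)]
    have e1 : F =ᶠ[𝓝 y] h := by
      filter_upwards [isOpen_ball.mem_nhds (hin y hy)] with z hz using hFe z hz
    have e2 : fderiv ℝ F =ᶠ[𝓝 y] fderiv ℝ h := e1.fderiv
    unfold lap
    refine Finset.sum_congr rfl fun j _ => ?_
    have e3 : (fun y => fderiv ℝ F y (EuclideanSpace.single j 1)) =ᶠ[𝓝 y]
      (fun y => fderiv ℝ h y (EuclideanSpace.single j 1)) := by
      filter_upwards [e2] with z hz
      rw [hz]
    rw [e3.fderiv_eq]
  have hψ := K.smooth.continuous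
  have hP := K.smoothP.continuous
  have hψc := PeakKernel.compact_of_supp K.supp
  have hPc := PeakKernel.compact_of_supp K.suppP
  have hF' : Continuous (fderiv ℝ F) := hF.continuous_fderiv (by simp)
  have hF'1 : ContDiff ℝ 1 (fderiv ℝ F) := hF.fderiv_right (by norm_num)
  have hder : ∀ s ∈ Icc 0 r, ∫ y, ψ y * fderiv ℝ F (x + s • y) y = 0 := by
    intro s hs
    let e : Fin n → EuclideanSpace ℝ (Fin n) := fun j => EuclideanSpace.single j 1
    have hq : ∀ j, ContDiff ℝ 1 (fun y => fderiv ℝ F (x + s • y) (e j)) := by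
      intro j
      exact (hF'1.comp (by fun_prop)).clm_apply contDiff_const
    have hqd : ∀ j y, fderiv ℝ (fun y => fderiv ℝ F (x + s • y) (e j)) y (e j) =
        s * fderiv ℝ (fun y => fderiv ℝ F y (e j)) (x + s • y) (e j) := by
      intro j y
      have h1 : HasFDerivAt (fun y : EuclideanSpace ℝ (Fin n) => x + s • y)
        (s • ContinuousLinearMap.id ℝ _) y := ((hasFDerivAt_id y).const_smul s).const_add x
      have h2 : DifferentiableAt ℝ (fun y => fderiv ℝ F y (e j)) (x + s • y) :=
        (hF'1.clm_apply contDiff_const).differentiable (by simp) _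
      have h3 := h2.hasFDerivAt.comp y h1
      have h4 : fderiv ℝ (fun y => fderiv ℝ F (x + s • y) (e j)) y = _ := h3.fderiv
      rw [h4]
      simp
    have hibp : ∀ j, ∫ y, fderiv ℝ F (x + s • y) (e j) * fderiv ℝ P y (e j) =
        - ∫ y, fderiv ℝ (fun y => fderiv ℝ F (x + s • y) (e j)) y (e j) * P y := by
      intro j
      have c1 : Continuous (fderiv ℝ (fun y => fderiv ℝ F (x + s • y) (e j))) :=
        (hq j).continuous_fderiv (by simp)
      have c2 : Continuous (fderiv ℝ P) := K.smoothP.continuous_fderiv (by simp)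
      have c3 := (hq j).continuous
      apply integral_mul_fderiv_eq_neg_fderiv_mul_of_integrable
      · exact Continuous.integrable_of_hasCompactSupport (by fun_prop) hPc.mul_left
      · refine Continuous.integrable_of_hasCompactSupport (by fun_prop) ?_
        exact HasCompactSupport.mul_left (hPc.fderiv_apply (𝕜 := ℝ) (e j))
      · exact Continuous.integrable_of_hasCompactSupport (by fun_prop) hPc.mul_left
      · intro y _
        exact (hq j).differentiable (by simp) y
      · intro y _
        exact K.smoothP.differentiable (by simp) y
    have hsum : ∀ y, ψ y * fderiv ℝ F (x + s • y) y =
        ∑ j, fderiv ℝ F (x + s • y) (e j) * fderiv ℝ P y (e j) := by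
      intro y
      have hy : y = ∑ j, y j • e j := by
        have := (EuclideanSpace.basisFun (Fin n) ℝ).sum_repr y
        simpa [e] using this.symm
      have hL : fderiv ℝ F (x + s • y) y = ∑ j, fderiv ℝ F (x + s • y) (y j • e j) := by
        rw [← map_sum, ← hy]
      rw [hL, Finset.mul_sum]
      refine Finset.sum_congr rfl fun j _ => ?_
      rw [K.grad, map_smul]
      simp [e, EuclideanSpace.inner_single_right]
      ring
    simp_rw [hsum]
    have hint : ∀ j, Integrable (fun y => fderiv ℝ F (x + s • y) (e j) * fderiv ℝ P y (e j)) := by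
      intro j
      have c2 : Continuous (fderiv ℝ P) := K.smoothP.continuous_fderiv (by simp)
      have c3 := (hq j).continuous
      refine Continuous.integrable_of_hasCompactSupport (by fun_prop) ?_
      exact HasCompactSupport.mul_left (hPc.fderiv_apply (𝕜 := ℝ) (e j))
    have hint2 : ∀ j, Integrable
        (fun y => fderiv ℝ (fun y => fderiv ℝ F (x + s • y) (e j)) y (e j) * P y) := by
      intro j
      have c1 : Continuous (fderiv ℝ (fun y => fderiv ℝ F (x + s • y) (e j))) :=
        (hq j).continuous_fderiv (by simp)
      exact Continuous.integrable_of_hasCompactSupport (by fun_prop) hPc.mul_left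
    rw [integral_finsetSum _ (fun j _ => hint j)]
    simp_rw [hibp]
    rw [Finset.sum_neg_distrib, ← integral_finsetSum _ (fun j _ => hint2 j), neg_eq_zero]
    refine integral_eq_zero_of_ae (Eventually.of_forall fun y => ?_)
    simp_rw [hqd]
    rw [← Finset.sum_mul, ← Finset.mul_sum]
    by_cases hy : 1 < ‖y‖
    · simp [K.suppP y hy]
    · have : lap F (x + s • y) = 0 := by
        apply hlap
        push Not at hy
        simp [norm_smul, abs_of_nonneg hs.1]
        nlinarith [hs.1, hs.2]
      unfold lap at this
      simp only [e]
      rw [this]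
      simp
  have hD := fun s => K.hasDerivAt_avg hF1 hFc (fun _ => x) (fun y => y)
    continuous_const continuous_id s
  have hconst := constant_of_has_deriv_right_zero
    (f := fun t : ℝ => ∫ y, ψ y * F (x + t • y)) (a := 0) (b := r)
    (fun s _ => (hD s).continuousAt.continuousWithinAt)
    (fun s hs => by
      have := (hD s).hasDerivWithinAt (s := Ici s)
      rwa [hder s ⟨hs.1, hs.2.le⟩] at this)
    r ⟨hr.le, le_rfl⟩
  simp only [zero_smul, add_zero, integral_mul_const, K.int, one_mul] at hconst
  rw [← PeakKernel.integral_congr K.supp hr.le (fun y hy => hFe y (hin y hy)), hconst]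
  exact (hFe x (hin x (mem_closedBall_self hr.le))).symm


theorem peak_zform {n : ℕ} (ψ f : EuclideanSpace ℝ (Fin n) → ℝ)
    (x : EuclideanSpace ℝ (Fin n)) {r : ℝ} (hr : 0 < r) :
    ∫ y, ψ y * f (x + r • y) = (r ^ n)⁻¹ * ∫ z, ψ (r⁻¹ • (z - x)) * f z := by
  have h1 := Measure.integral_comp_smul_of_nonneg (volume : Measure (EuclideanSpace ℝ (Fin n)))
    (fun u => ψ (r⁻¹ • u) * f (x + u)) r (hR := hr.le)
  have h2 := integral_add_left_eq_self (μ := (volume : Measure (EuclideanSpace ℝ (Fin n))))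
    (fun z => ψ (r⁻¹ • (z - x)) * f z) x
  simp only [add_sub_cancel_left] at h2
  rw [← h2]
  simp only [smul_smul, inv_mul_cancel₀ hr.ne', one_smul, finrank_euclideanSpace, Fintype.card_fin,
    smul_eq_mul] at h1
  exact h1

theorem PeakMV.zform {n : ℕ} {ψ f : EuclideanSpace ℝ (Fin n) → ℝ}
    {G : Set (EuclideanSpace ℝ (Fin n))} (hf : PeakMV ψ G f) {x : EuclideanSpace ℝ (Fin n)} {r : ℝ}
    (hr : 0 < r) (hx : closedBall x r ⊆ G) :
    f x = (r ^ n)⁻¹ * ∫ z, ψ (r⁻¹ • (z - x)) * f z := by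
  rw [hf.2 x r hr hx, peak_zform ψ f x hr]

theorem peak_kernel_zero {n : ℕ} {ψ : EuclideanSpace ℝ (Fin n) → ℝ}
    (hψ : ∀ y, 1 < ‖y‖ → ψ y = 0) {x z : EuclideanSpace ℝ (Fin n)} {r : ℝ} (hr : 0 < r)
    (hz : z ∉ closedBall x r) : ψ (r⁻¹ • (z - x)) = 0 := by
  apply hψ
  simp only [mem_closedBall, not_le, dist_eq_norm] at hz
  rw [norm_smul, norm_inv, Real.norm_eq_abs, abs_of_pos hr, inv_mul_eq_div, lt_div_iff₀ hr]
  linarith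

theorem peak_integrable {n : ℕ} {P ψ : EuclideanSpace ℝ (Fin n) → ℝ} (K : PeakKernel n P ψ)
    {G : Set (EuclideanSpace ℝ (Fin n))} {f : EuclideanSpace ℝ (Fin n) → ℝ}
    (hf : ContinuousOn f G) {x : EuclideanSpace ℝ (Fin n)} {r : ℝ} (hr : 0 < r)
    (hx : closedBall x r ⊆ G) : Integrable (fun z => ψ (r⁻¹ • (z - x)) * f z) := by
  have hψ := K.smooth.continuous
  rw [← integrableOn_iff_integrable_of_support_subset (s := closedBall x r)]
  · refine ContinuousOn.integrableOn_compact (isCompact_closedBall x r) ?_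
    refine ContinuousOn.mul (Continuous.continuousOn (by fun_prop)) (hf.mono hx)
  · intro z hz
    by_contra h
    apply hz
    simp [peak_kernel_zero K.supp hr h]

/-- the L¹ bound -/
theorem PeakMV.l1_bound {n : ℕ} {P ψ f : EuclideanSpace ℝ (Fin n) → ℝ} (K : PeakKernel n P ψ)
    {G : Set (EuclideanSpace ℝ (Fin n))} (hG : IsOpen G) (hf : PeakMV ψ G f)
    (hfi : IntegrableOn f G) {A : ℝ} (hA : ∀ y, |ψ y| ≤ A)
    {x : EuclideanSpace ℝ (Fin n)} {r : ℝ} (hr : 0 < r) (hx : closedBall x r ⊆ G) :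
    |f x| ≤ (r ^ n)⁻¹ * (A * ∫ z in G, |f z|) := by
  have hA0 : 0 ≤ A := (abs_nonneg _).trans (hA 0)
  rw [hf.zform hr hx, abs_mul, abs_of_pos (by positivity : 0 < (r ^ n)⁻¹)]
  gcongr
  rw [← integral_indicator hG.measurableSet, ← integral_const_mul]
  rw [← Real.norm_eq_abs]
  apply norm_integral_le_of_norm_le
  · exact (IntegrableOn.integrable_indicator hfi.abs hG.measurableSet).const_mul A
  · refine Eventually.of_forall fun z => ?_
    by_cases hz : z ∈ closedBall x r
    · rw [indicator_of_mem (hx hz), norm_mul]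
      exact mul_le_mul_of_nonneg_right (hA _) (abs_nonneg _)
    · rw [peak_kernel_zero K.supp hr hz]
      simp only [zero_mul, norm_zero]
      exact mul_nonneg hA0 (indicator_nonneg (fun _ _ => abs_nonneg _) _)

/-- The Lipschitz estimate. -/
theorem PeakKernel.exists_lip {n : ℕ} {P ψ : EuclideanSpace ℝ (Fin n) → ℝ} (K : PeakKernel n P ψ) :
    ∃ C : ℝ, 0 ≤ C ∧ ∀ (G : Set (EuclideanSpace ℝ (Fin n))) (f : EuclideanSpace ℝ (Fin n) → ℝ),
      PeakMV ψ G f → ∀ x r M, 0 < r → closedBall x (2 * r) ⊆ G →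
      (∀ y ∈ closedBall x (2 * r), |f y| ≤ M) → ∀ w, ‖w‖ ≤ r →
      |f (x + w) - f x| ≤ C / r * M * ‖w‖ := by
  obtain ⟨B, hB⟩ := K.smooth.lipschitzWith_of_hasCompactSupport
    (compact_of_supp K.supp) (by simp)
  let V : ℝ := (volume : Measure (EuclideanSpace ℝ (Fin n))).real (ball 0 1)
  refine ⟨B * (2 ^ n * V), by positivity, ?_⟩
  intro G f hf x r M hr hx hM w hw
  have hM0 : 0 ≤ M := (abs_nonneg _).trans (hM x (mem_closedBall_self (by positivity)))
  have hx1 : closedBall x r ⊆ closedBall x (2 * r) := closedBall_subset_closedBall (by linarith)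
  have hx2 : closedBall (x + w) r ⊆ closedBall x (2 * r) := by
    apply closedBall_subset_closedBall'
    simp [dist_eq_norm]
    linarith
  rw [hf.zform hr (hx2.trans hx), hf.zform hr (hx1.trans hx), ← mul_sub,
    ← integral_sub (peak_integrable K hf.1 hr (hx2.trans hx))
      (peak_integrable K hf.1 hr (hx1.trans hx)), abs_mul,
    abs_of_pos (by positivity : 0 < (r ^ n)⁻¹), ← Real.norm_eq_abs]
  have hbd : ‖∫ z, (ψ (r⁻¹ • (z - (x + w))) * f z - ψ (r⁻¹ • (z - x)) * f z)‖ ≤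
      ∫ z, (closedBall x (2 * r)).indicator (fun _ => B * (r⁻¹ * ‖w‖) * M) z := by
    apply norm_integral_le_of_norm_le
    · refine IntegrableOn.integrable_indicator ?_ measurableSet_closedBall
      exact integrableOn_const (measure_closedBall_lt_top.ne)
    · refine Eventually.of_forall fun z => ?_
      by_cases hz : z ∈ closedBall x (2 * r)
      · rw [indicator_of_mem hz, ← sub_mul, norm_mul]
        gcongr
        · have := hB.dist_le_mul (r⁻¹ • (z - (x + w))) (r⁻¹ • (z - x))
          rw [dist_eq_norm, dist_eq_norm, ← smul_sub, norm_smul, norm_inv, Real.norm_eq_abs,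
            Real.norm_eq_abs, abs_of_pos hr] at this
          simpa using this
        · exact hM z hz
      · rw [indicator_of_notMem hz, peak_kernel_zero K.supp hr (fun h => hz (hx1 h)),
          peak_kernel_zero K.supp hr (fun h => hz (hx2 h))]
        simp
  rw [integral_indicator measurableSet_closedBall, setIntegral_const,
    Measure.addHaar_real_closedBall _ _ (by positivity)] at hbd
  simp only [finrank_euclideanSpace, Fintype.card_fin, smul_eq_mul] at hbd
  calc _ ≤ (r ^ n)⁻¹ * ((2 * r) ^ n * V * (B * (r⁻¹ * ‖w‖) * M)) := by
        gcongr
    _ = _ := by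
        rw [mul_pow]
        field_simp

theorem PeakMV.contDiffOn {n : ℕ} {P ψ f : EuclideanSpace ℝ (Fin n) → ℝ} (K : PeakKernel n P ψ)
    {G : Set (EuclideanSpace ℝ (Fin n))} (hG : IsOpen G) (hf : PeakMV ψ G f) :
    ContDiffOn ℝ ∞ f G := by
  intro x₀ hx₀
  apply ContDiffAt.contDiffWithinAt
  obtain ⟨ε, hε, hb⟩ := Metric.nhds_basis_closedBall.mem_iff.1 (hG.mem_nhds hx₀)
  obtain ⟨r, rfl⟩ : ∃ r, ε = 2 * r := ⟨ε / 2, by ring⟩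
  have hr : 0 < r := by linarith
  let Φ := (closedBall x₀ (2 * r)).indicator f
  let g : EuclideanSpace ℝ (Fin n) → ℝ := fun u => ψ (-(r⁻¹ • u))
  have hg : ContDiff ℝ ∞ g := K.smooth.comp (by fun_prop)
  have hgc : HasCompactSupport g := by
    refine HasCompactSupport.intro (isCompact_closedBall (0 : EuclideanSpace ℝ (Fin n)) r) ?_
    intro u hu
    have := peak_kernel_zero (x := u) (z := 0) K.supp hr (by simpa using hu)
    simpa [g] using this
  have hΦ : Integrable Φ := by
    refine IntegrableOn.integrable_indicator ?_ measurableSet_closedBall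
    exact (hf.1.mono hb).integrableOn_compact (isCompact_closedBall _ _)
  have hconv := hgc.contDiff_convolution_right (n := ⊤) (ContinuousLinearMap.mul ℝ ℝ)
    hΦ.locallyIntegrable hg
  have hc : ContDiff ℝ ∞ (fun x => (r ^ n)⁻¹ *
    (convolution Φ g (ContinuousLinearMap.mul ℝ ℝ) volume) x) := contDiff_const.mul hconv
  refine hc.contDiffAt.congr_of_eventuallyEq ?_
  filter_upwards [ball_mem_nhds x₀ hr] with x hx
  have hxs : closedBall x r ⊆ closedBall x₀ (2 * r) := by
    apply closedBall_subset_closedBall'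
    have := mem_ball.1 hx
    linarith
  rw [hf.zform hr (hxs.trans hb), convolution_def]
  congr 2
  ext z
  simp only [ContinuousLinearMap.mul_apply', g, Φ]
  rw [← smul_neg, neg_sub, mul_comm]
  by_cases hz : z ∈ closedBall x r
  · rw [indicator_of_mem (hxs hz)]
  · rw [peak_kernel_zero K.supp hr hz]
    simp

theorem PeakMV.deriv {n : ℕ} {P ψ f : EuclideanSpace ℝ (Fin n) → ℝ} (K : PeakKernel n P ψ)
    {G : Set (EuclideanSpace ℝ (Fin n))} (hG : IsOpen G) (hf : PeakMV ψ G f)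
    (v : EuclideanSpace ℝ (Fin n)) : PeakMV ψ G (fun x => fderiv ℝ f x v) := by
  have hs := hf.contDiffOn K hG
  refine ⟨(hs.continuousOn_fderiv_of_isOpen hG (by simp)).clm_apply continuousOn_const, ?_⟩
  intro x r hr hx
  obtain ⟨F, hF, hFc, δ, hδ, hδG, hFe⟩ :=
    exists_cutoff hG (k := 1) (hs.of_le (by simp)) hr hx
  have hD := K.hasDerivAt_avg hF hFc (fun y => x + r • y) (fun _ => v)
    (by fun_prop) continuous_const 0
  have h1 : HasDerivAt (fun t : ℝ => x + t • v) v 0 := by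
    simpa using ((hasDerivAt_id (0 : ℝ)).smul_const v).const_add x
  have hxG : x ∈ G := hx (mem_closedBall_self hr.le)
  have hfx : HasFDerivAt f (fderiv ℝ f x) (x + (0 : ℝ) • v) := by
    rw [zero_smul, add_zero]
    exact ((hs.contDiffAt (hG.mem_nhds hxG)).differentiableAt (by simp)).hasFDerivAt
  have h2 := hfx.comp_hasDerivAt (0 : ℝ) h1
  have hev : (fun t : ℝ => ∫ y, ψ y * F (x + r • y + t • v)) =ᶠ[𝓝 0]
      (f ∘ fun t : ℝ => x + t • v) := by
    have hc : Tendsto (fun t : ℝ => ‖t • v‖) (𝓝 0) (𝓝 0) := by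
      have : Continuous (fun t : ℝ => ‖t • v‖) := by fun_prop
      simpa using this.tendsto 0
    filter_upwards [hc.eventually (gt_mem_nhds hδ)] with t ht
    have hsub : closedBall (x + t • v) r ⊆ ball x (r + δ) := by
      intro y hy
      rw [mem_ball]
      have h3 := dist_triangle y (x + t • v) x
      have h4 : dist (x + t • v) x = ‖t • v‖ := by simp [dist_eq_norm]
      have h5 := mem_closedBall.1 hy
      linarith
    rw [Function.comp_apply, hf.2 _ r hr (hsub.trans hδG),
      ← PeakKernel.integral_congr K.supp hr.le (fun y hy => hFe y (hsub hy))]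
    congr 1
    ext y
    congr 2
    abel
  have h3 := h2.unique (hD.congr_of_eventuallyEq hev.symm)
  simp only at h3 ⊢
  rw [h3]
  congr 1
  ext y
  by_cases hy : 1 < ‖y‖
  · simp [K.supp y hy]
  · have hmem : x + r • y ∈ ball x (r + δ) := by
      push Not at hy
      simp [norm_smul, abs_of_pos hr]
      nlinarith
    have e1 : F =ᶠ[𝓝 (x + r • y)] f := by
      filter_upwards [isOpen_ball.mem_nhds hmem] with z hz using hFe z hz
    simp [e1.fderiv_eq]

/-- Directional derivative. -/
noncomputable def peakD {n : ℕ} (v : EuclideanSpace ℝ (Fin n)) (f : EuclideanSpace ℝ (Fin n) → ℝ) :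
    EuclideanSpace ℝ (Fin n) → ℝ := fun x => fderiv ℝ f x v

theorem PeakMV.iter {n : ℕ} {P ψ f : EuclideanSpace ℝ (Fin n) → ℝ} (K : PeakKernel n P ψ)
    {G : Set (EuclideanSpace ℝ (Fin n))} (hG : IsOpen G) (hf : PeakMV ψ G f)
    (v : EuclideanSpace ℝ (Fin n)) (k : ℕ) : PeakMV ψ G ((peakD v)^[k] f) := by
  induction k with
  | zero => exact hf
  | succ k ih =>
    rw [Function.iterate_succ_apply']
    exact ih.deriv K hG v

theorem PeakKernel.exists_deriv_bound {n : ℕ} {P ψ : EuclideanSpace ℝ (Fin n) → ℝ}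
    (K : PeakKernel n P ψ) :
    ∃ C : ℝ, 0 ≤ C ∧ ∀ (G : Set (EuclideanSpace ℝ (Fin n))), IsOpen G → ∀ (k : ℕ)
      (f : EuclideanSpace ℝ (Fin n) → ℝ),
      PeakMV ψ G f → ∀ x r M v, 0 < r → closedBall x (k * (2 * r)) ⊆ G →
      (∀ y ∈ closedBall x (k * (2 * r)), |f y| ≤ M) →
      |((peakD v)^[k] f) x| ≤ (C / r * ‖v‖) ^ k * M := by
  obtain ⟨C, hC0, hC⟩ := K.exists_lip
  refine ⟨C, hC0, ?_⟩
  intro G hG k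
  induction k with
  | zero =>
    intro f hf x r M v hr hx hM
    simpa using hM x (by simp)
  | succ k ih =>
    intro f hf x r M v hr hx hM
    rw [Function.iterate_succ_apply]
    have hsub : ∀ y ∈ closedBall x (k * (2 * r)), closedBall y (2 * r) ⊆
        closedBall x ((k + 1 : ℕ) * (2 * r)) := by
      intro y hy
      apply closedBall_subset_closedBall'
      have := mem_closedBall.1 hy
      push_cast
      linarith
    have := ih (peakD v f) (hf.deriv K hG v) x r (C / r * ‖v‖ * M) v hr ?_ ?_
    · rw [pow_succ, mul_assoc]
      exact this
    · refine (closedBall_subset_closedBall ?_).trans hx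
      push_cast
      nlinarith
    · intro y hy
      have hM0 : 0 ≤ M := (abs_nonneg _).trans (hM y (hsub y hy (mem_closedBall_self (by positivity))))
      have h1 : ‖fderiv ℝ f y‖ ≤ C / r * M := by
        apply norm_fderiv_le_of_lip' ℝ (by positivity)
        filter_upwards [closedBall_mem_nhds y hr] with z hz
        have := hC G f hf y r M hr ((hsub y hy).trans hx) (fun w hw => hM w (hsub y hy hw)) (z - y)
          (by simpa [dist_eq_norm] using hz)
        simpa using this
      calc |peakD v f y| ≤ ‖fderiv ℝ f y‖ * ‖v‖ := (fderiv ℝ f y).le_opNorm v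
        _ ≤ C / r * M * ‖v‖ := by gcongr
        _ = _ := by ring



theorem peak_taylor (C : ℝ) (k : ℕ) : ∀ (g : ℕ → ℝ → ℝ),
    (∀ j, ∀ t ∈ Icc (0 : ℝ) 1, HasDerivAt (g j) (g (j + 1) t) t) → (∀ j, g j 0 = 0) →
    (∀ t ∈ Icc (0 : ℝ) 1, |g k t| ≤ C) →
    ∀ t ∈ Icc (0 : ℝ) 1, |g 0 t| ≤ C * (t ^ k / k.factorial) := by
  induction k with
  | zero => intro g _ _ h t ht; simpa using h t ht
  | succ k ih =>
    intro g hd h0 hb t ht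
    have h1 := ih (fun j => g (j + 1)) (fun j => hd (j + 1)) (fun j => h0 (j + 1)) hb
    have hB : ∀ t : ℝ, HasDerivAt (fun t : ℝ => C * (t ^ (k + 1) / (k + 1).factorial))
        (C * (t ^ k / k.factorial)) t := by
      intro t
      have := ((hasDerivAt_pow (k + 1) t).div_const ((k + 1).factorial : ℝ)).const_mul C
      refine this.congr_deriv ?_
      rw [Nat.factorial_succ]
      push_cast
      have : (k.factorial : ℝ) ≠ 0 := by positivity
      field_simp
    have := image_norm_le_of_norm_deriv_right_le_deriv_boundary (f := g 0) (f' := g 1) (a := 0)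
      (b := 1) (B := fun t : ℝ => C * (t ^ (k + 1) / (k + 1).factorial))
      (B' := fun t => C * (t ^ k / k.factorial))
      (fun t ht => (hd 0 t ht).continuousAt.continuousWithinAt)
      (fun t ht => (hd 0 t ⟨ht.1, ht.2.le⟩).hasDerivWithinAt) (by simp [h0]) hB
      (fun t ht => h1 t ⟨ht.1, ht.2.le⟩)
    exact this ht

theorem PeakMV.eventually_zero {n : ℕ} {P ψ f : EuclideanSpace ℝ (Fin n) → ℝ}
    (K : PeakKernel n P ψ)
    {G : Set (EuclideanSpace ℝ (Fin n))} (hG : IsOpen G) (hf : PeakMV ψ G f)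
    {x : EuclideanSpace ℝ (Fin n)} (hx : x ∈ G) {D : Set (EuclideanSpace ℝ (Fin n))}
    (hD : Dense D) (h0 : ∀ v ∈ D, ∀ k, ((peakD v)^[k] f) x = 0) : ∀ᶠ y in 𝓝 x, f y = 0 := by
  obtain ⟨C, hC0, hC⟩ := K.exists_deriv_bound
  obtain ⟨ε, hε, hb⟩ := Metric.nhds_basis_closedBall.mem_iff.1 (hG.mem_nhds hx)
  obtain ⟨R, rfl⟩ : ∃ R, ε = 2 * R := ⟨ε / 2, by ring⟩
  have hR : 0 < R := by linarith
  obtain ⟨M, hM⟩ := (isCompact_closedBall x (2 * R)).exists_bound_of_continuousOn (hf.1.mono hb)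
  have hM0 : 0 ≤ M := (norm_nonneg _).trans (hM x (mem_closedBall_self hε.le))
  let q := 4 * C * Real.exp 1
  have hq : 0 ≤ q := by positivity
  let δ := R / (1 + q)
  have hδ : 0 < δ := by positivity
  have hδR : δ ≤ R := div_le_self hR.le (by linarith)
  have main : ∀ v ∈ D, ‖v‖ < δ → f (x + v) = 0 := by
    intro v hv hvδ
    have hin : ∀ t ∈ Icc (0 : ℝ) 1, closedBall (x + t • v) R ⊆ closedBall x (2 * R) := by
      intro t ht
      apply closedBall_subset_closedBall'
      simp only [dist_eq_norm, add_sub_cancel_left, norm_smul, Real.norm_eq_abs, abs_of_nonneg ht.1]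
      nlinarith [ht.1, ht.2, norm_nonneg v]
    have hbound : ∀ k : ℕ, |f (x + v)| ≤ M * (1 / 2) ^ (k + 1) := by
      intro k
      let r := R / (2 * (k + 1))
      have hr : 0 < r := by positivity
      have hkr : ((k + 1 : ℕ) : ℝ) * (2 * r) = R := by
        simp only [r]; push_cast; field_simp
      have := peak_taylor ((C / r * ‖v‖) ^ (k + 1) * M) (k + 1)
        (fun j t => ((peakD v)^[j] f) (x + t • v)) ?_ ?_ ?_ 1 (by simp)
      · simp only [Function.iterate_zero, id_eq, one_smul, one_pow] at this
        refine this.trans ?_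
        have h1 : C / r * ‖v‖ = (k + 1 : ℕ) * (2 * C * ‖v‖ / R) := by
          simp only [r]; push_cast; field_simp
        have h2 := Real.pow_div_factorial_le_exp ((k + 1 : ℕ) : ℝ) (by positivity) (k + 1)
        have h3 : Real.exp ((k + 1 : ℕ) : ℝ) = Real.exp 1 ^ (k + 1) := by
          rw [← Real.exp_nat_mul, mul_one]
        rw [h1, mul_pow]
        calc _ = (2 * C * ‖v‖ / R) ^ (k + 1) * M *
              (((k + 1 : ℕ) : ℝ) ^ (k + 1) / (k + 1).factorial) := by ring
          _ ≤ (2 * C * ‖v‖ / R) ^ (k + 1) * M * Real.exp 1 ^ (k + 1) := by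
              rw [← h3]; gcongr
          _ = M * (2 * C * ‖v‖ / R * Real.exp 1) ^ (k + 1) := by rw [mul_pow]; ring
          _ ≤ _ := by
              gcongr
              have h4 : ‖v‖ * (1 + q) ≤ R := by
                rw [← le_div_iff₀ (by positivity)]; exact hvδ.le
              have h5 : 2 * C * ‖v‖ / R * Real.exp 1 = (‖v‖ * q) / (2 * R) := by
                simp only [q]; field_simp; ring
              rw [h5, div_le_div_iff₀ (by positivity) (by positivity)]
              nlinarith [norm_nonneg v]
      · intro j t ht
        have h1 : HasDerivAt (fun t : ℝ => x + t • v) v t := by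
          simpa using ((hasDerivAt_id t).smul_const v).const_add x
        have hmem : x + t • v ∈ G := hb (hin t ht (mem_closedBall_self hR.le))
        have h2 := ((((hf.iter K hG v j).contDiffOn K hG).contDiffAt
          (hG.mem_nhds hmem)).differentiableAt (by simp)).hasFDerivAt.comp_hasDerivAt t h1
        simp only [Function.iterate_succ_apply']
        exact h2
      · intro j
        simpa using h0 v hv j
      · intro t ht
        apply hC G hG (k + 1) f hf (x + t • v) r M v hr
        · rw [hkr]; exact (hin t ht).trans hb
        · rw [hkr]; intro y hy; exact hM y (hin t ht hy)
    have hlim : Tendsto (fun k : ℕ => M * (1 / 2 : ℝ) ^ (k + 1)) atTop (𝓝 (M * 0)) :=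
      ((tendsto_pow_atTop_nhds_zero_of_lt_one (by norm_num) (by norm_num)).comp
        (tendsto_add_atTop_nat 1)).const_mul M
    have := ge_of_tendsto' hlim hbound
    rw [mul_zero] at this
    exact abs_nonpos_iff.1 this
  filter_upwards [ball_mem_nhds x hδ] with y hy
  by_contra hne
  have hyG : y ∈ G := hb (closedBall_subset_closedBall (by linarith) (ball_subset_closedBall hy))
  have hev : ∀ᶠ z in 𝓝 y, f z ≠ 0 ∧ z ∈ ball x δ :=
    ((hf.1.continuousAt (hG.mem_nhds hyG)).eventually_ne hne).and (isOpen_ball.mem_nhds hy)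
  have hc : Tendsto (fun v => x + v) (𝓝 (y - x)) (𝓝 y) := by
    have : Continuous (fun v => x + v) := by fun_prop
    simpa using this.tendsto (y - x)
  obtain ⟨v, hvD, hv⟩ := (hD.inter_nhds_nonempty (hc.eventually hev))
  exact hv.1 (main v hvD (by simpa using hv.2))

theorem PeakMV.ae_deriv_zero {n : ℕ} {P ψ f : EuclideanSpace ℝ (Fin n) → ℝ}
    (K : PeakKernel n P ψ)
    {G : Set (EuclideanSpace ℝ (Fin n))} (hG : IsOpen G) (hf : PeakMV ψ G f)
    {Z : Set (EuclideanSpace ℝ (Fin n))} (hZ : MeasurableSet Z) (hZG : Z ⊆ G)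
    (h0 : ∀ᵐ x, x ∈ Z → f x = 0) (v : EuclideanSpace ℝ (Fin n)) :
    ∀ᵐ x, x ∈ Z → peakD v f x = 0 := by
  let U := G ∩ f ⁻¹' {0}ᶜ
  have hU : IsOpen U := hf.1.isOpen_inter_preimage hG isOpen_compl_singleton
  have hs : MeasurableSet (Z \ U) := hZ.diff hU.measurableSet
  have hs0 : ∀ x ∈ Z \ U, f x = 0 := by
    intro x hx
    by_contra h
    exact hx.2 ⟨hZG hx.1, h⟩
  have happ : ApproximatesLinearOn (fun x => f x • v)
      (0 : EuclideanSpace ℝ (Fin n) →L[ℝ] EuclideanSpace ℝ (Fin n)) (Z \ U) 0 := by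
    intro x hx y hy
    simp [hs0 x hx, hs0 y hy]
  have := happ.norm_fderiv_sub_le volume hs (fun x => (fderiv ℝ f x).smulRight v) (by
    intro x hx
    exact ((((hf.contDiffOn K hG).contDiffAt (hG.mem_nhds (hZG hx.1))).differentiableAt
      (by simp)).hasFDerivAt.smul_const v).hasFDerivWithinAt)
  rw [ae_restrict_iff' hs] at this
  filter_upwards [this, h0] with x hx1 hx2 hxZ
  have h3 := hx1 ⟨hxZ, fun hxU => hxU.2 (hx2 hxZ)⟩
  simp only [sub_zero, nonpos_iff_eq_zero, nnnorm_eq_zero] at h3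
  have h4 := congrArg (fun L => L v) h3
  simp only [ContinuousLinearMap.smulRight_apply, zero_apply,
    smul_eq_zero] at h4
  rcases h4 with h | h
  · exact h
  · simp [peakD, h]

theorem PeakMV.unique_continuation {n : ℕ} {P ψ f : EuclideanSpace ℝ (Fin n) → ℝ}
    (K : PeakKernel n P ψ)
    {G : Set (EuclideanSpace ℝ (Fin n))} (hG : IsOpen G) (hGc : IsPreconnected G)
    (hf : PeakMV ψ G f)
    {Z : Set (EuclideanSpace ℝ (Fin n))} (hZ : MeasurableSet Z) (hZG : Z ⊆ G)
    (hZ0 : volume Z ≠ 0) (h0 : ∀ᵐ x, x ∈ Z → f x = 0) : ∀ x ∈ G, f x = 0 := by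
  obtain ⟨D, hDc, hDd⟩ := TopologicalSpace.exists_countable_dense (EuclideanSpace ℝ (Fin n))
  have hae : ∀ᵐ x, ∀ v ∈ D, ∀ k, x ∈ Z → ((peakD v)^[k] f) x = 0 := by
    rw [ae_ball_iff hDc]
    intro v _
    rw [ae_all_iff]
    intro k
    induction k with
    | zero => exact h0
    | succ k ih =>
      simp only [Function.iterate_succ_apply']
      exact (hf.iter K hG v k).ae_deriv_zero K hG hZ hZG ih v
  obtain ⟨x₀, hx₀Z, hx₀⟩ : ∃ x ∈ Z, ∀ v ∈ D, ∀ k, ((peakD v)^[k] f) x = 0 := by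
    by_contra hcon
    push Not at hcon
    apply hZ0
    refine measure_mono_null ?_ (ae_iff.1 hae)
    intro x hx hx2
    obtain ⟨v, hv, k, hk⟩ := hcon x hx
    exact hk (hx2 v hv k hx)
  let V : Set (EuclideanSpace ℝ (Fin n)) := {x | ∀ᶠ y in 𝓝 x, f y = 0}
  have hV : IsOpen V := isOpen_setOfPred_eventually_nhds
  have hiter : ∀ v k, ∀ x ∈ V, ((peakD v)^[k] f) x = 0 := by
    intro v k
    have : ∀ x ∈ V, ((peakD v)^[k] f) =ᶠ[𝓝 x] fun _ => 0 := by
      induction k with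
      | zero => intro x hx; exact hx
      | succ k ih =>
        intro x hx
        rw [Function.iterate_succ_apply']
        filter_upwards [(ih x hx).fderiv (𝕜 := ℝ)] with y hy
        simp [peakD, hy]
    intro x hx
    exact (this x hx).eq_of_nhds
  have hsub : G ⊆ V := by
    refine hGc.subset_of_closure_inter_subset hV
      ⟨x₀, hZG hx₀Z, hf.eventually_zero K hG (hZG hx₀Z) hDd hx₀⟩ ?_
    rintro x ⟨hxc, hxG⟩
    refine hf.eventually_zero K hG hxG dense_univ ?_
    intro v _ k
    have hc := (hf.iter K hG v k).1.continuousAt (hG.mem_nhds hxG)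
    by_contra hne
    obtain ⟨y, hy1, hy2⟩ := mem_closure_iff_nhds.1 hxc _ (hc.eventually_ne hne)
    exact hy1 (hiter v k y hy2)
  intro x hx
  exact (show ∀ᶠ y in 𝓝 x, f y = 0 from hsub hx).self_of_nhds



theorem PeakKernel.compactness {n : ℕ} {P ψ : EuclideanSpace ℝ (Fin n) → ℝ}
    (K : PeakKernel n P ψ)
    {G : Set (EuclideanSpace ℝ (Fin n))} (hG : IsOpen G)
    (u : ℕ → EuclideanSpace ℝ (Fin n) → ℝ) (hu : ∀ k, PeakMV ψ G (u k))
    (hb : ∀ x r, 0 < r → closedBall x r ⊆ G → ∃ M, ∀ k, ∀ y ∈ closedBall x r, |u k y| ≤ M) :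
    ∃ φ : ℕ → ℕ, StrictMono φ ∧ ∃ f, PeakMV ψ G f ∧
      ∀ x ∈ G, Tendsto (fun k => u (φ k) x) atTop (𝓝 (f x)) := by
  obtain ⟨C, hC0, hC⟩ := K.exists_lip
  obtain ⟨D, hDc, hDd⟩ := TopologicalSpace.exists_countable_dense (EuclideanSpace ℝ (Fin n))
  have hloc : ∀ x ∈ G, ∃ R > 0, closedBall x (2 * R) ⊆ G := by
    intro x hx
    obtain ⟨ε, hε, h⟩ := Metric.nhds_basis_closedBall.mem_iff.1 (hG.mem_nhds hx)
    exact ⟨ε / 2, by positivity, by rwa [mul_div_cancel₀ _ two_ne_zero]⟩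
  have hlip : ∀ x ∈ G, ∃ R > 0, ∃ L, ∀ k, |u k x| ≤ L ∧
      ∀ w, ‖w‖ ≤ R → |u k (x + w) - u k x| ≤ L * ‖w‖ := by
    intro x hx
    obtain ⟨R, hR, hRG⟩ := hloc x hx
    obtain ⟨M, hM⟩ := hb x (2 * R) (by positivity) hRG
    refine ⟨R, hR, max M (C / R * M), fun k => ⟨?_, fun w hw => ?_⟩⟩
    · exact (hM k x (mem_closedBall_self (by positivity))).trans (le_max_left _ _)
    · refine (hC G (u k) (hu k) x R M hR hRG (hM k) w hw).trans ?_
      gcongr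
      exact le_max_right _ _
  let S : Set (EuclideanSpace ℝ (Fin n)) := D ∩ G
  have hSc : Countable S := (hDc.mono inter_subset_left).to_subtype
  have hS : ∀ s : S, ∃ L, ∀ k, |u k s| ≤ L := by
    intro s
    obtain ⟨R, -, L, hL⟩ := hlip s s.2.2
    exact ⟨L, fun k => (hL k).1⟩
  choose L hL using hS
  have hcomp : IsCompact (pi univ fun s : S => Icc (-L s) (L s)) :=
    isCompact_univ_pi fun s => isCompact_Icc
  obtain ⟨a, -, φ, hφ, ha⟩ := hcomp.tendsto_subseq (x := fun k (s : S) => u k s)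
    (fun k s _ => abs_le.1 (hL s k))
  rw [tendsto_pi_nhds] at ha
  have hlim : ∀ x ∈ G, ∃ b, Tendsto (fun k => u (φ k) x) atTop (𝓝 b) := by
    intro x hx
    apply cauchySeq_tendsto_of_complete
    rw [Metric.cauchySeq_iff']
    intro ε hε
    obtain ⟨R, hR, L, hL⟩ := hlip x hx
    have hL0 : 0 ≤ L := (abs_nonneg _).trans (hL 0).1
    let δ := min R (ε / (4 * (L + 1)))
    have hδ : 0 < δ := by positivity
    obtain ⟨s, hsD, hs⟩ := hDd.inter_nhds_nonempty
      (inter_mem (ball_mem_nhds x hδ) (hG.mem_nhds hx))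
    have hsn : ‖s - x‖ < δ := by simpa [dist_eq_norm] using hs.1
    have hclose : ∀ k, |u k s - u k x| ≤ ε / 4 := by
      intro k
      have h1 := (hL k).2 (s - x) (hsn.le.trans (min_le_left _ _))
      rw [add_sub_cancel] at h1
      refine h1.trans ?_
      calc L * ‖s - x‖ ≤ (L + 1) * (ε / (4 * (L + 1))) := by
            gcongr
            · linarith
            · exact hsn.le.trans (min_le_right _ _)
        _ = ε / 4 := by field_simp
    obtain ⟨N, hN⟩ := Metric.cauchySeq_iff'.1 (ha ⟨s, hsD, hs.2⟩).cauchySeq (ε / 4) (by positivity)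
    refine ⟨N, fun k hk => ?_⟩
    have h1 := hN k hk
    simp only [Function.comp_apply, Real.dist_eq] at h1 ⊢
    have h2 := abs_le.1 (hclose (φ k))
    have h3 := abs_le.1 (hclose (φ N))
    have h4 := abs_lt.1 h1
    rw [abs_lt]
    constructor <;> linarith
  choose! f hf using hlim
  refine ⟨φ, hφ, f, ⟨?_, ?_⟩, hf⟩
  · intro x hx
    apply ContinuousAt.continuousWithinAt
    obtain ⟨R, hR, L, hL⟩ := hlip x hx
    have hbd : ∀ᶠ y in 𝓝 x, ‖f y - f x‖ ≤ L * ‖y - x‖ := by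
      filter_upwards [closedBall_mem_nhds x hR, hG.mem_nhds hx] with y hy hyG
      refine le_of_tendsto ((hf y hyG).sub (hf x hx)).norm (Eventually.of_forall fun k => ?_)
      have := (hL (φ k)).2 (y - x) (by simpa [dist_eq_norm] using hy)
      simpa using this
    have hz : Tendsto (fun y => L * ‖y - x‖) (𝓝 x) (𝓝 0) := by
      have : Continuous (fun y => L * ‖y - x‖) := by fun_prop
      simpa using this.tendsto x
    exact tendsto_iff_norm_sub_tendsto_zero.2 (squeeze_zero' (Eventually.of_forall fun _ => norm_nonneg _) hbd hz)
  · intro x r hr hx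
    obtain ⟨M, hM⟩ := hb x r hr hx
    obtain ⟨A, hA⟩ := (PeakKernel.compact_of_supp K.supp).exists_bound_of_continuous
      K.smooth.continuous
    have hA0 : 0 ≤ A := (norm_nonneg _).trans (hA 0)
    rw [peak_zform ψ f x hr]
    have h1 : Tendsto (fun k => ∫ z, ψ (r⁻¹ • (z - x)) * u (φ k) z) atTop
        (𝓝 (∫ z, ψ (r⁻¹ • (z - x)) * f z)) := by
      refine tendsto_integral_of_dominated_convergence
        ((closedBall x r).indicator fun _ => A * M) ?_ ?_ ?_ ?_
      · exact fun k => (peak_integrable K (hu (φ k)).1 hr hx).aestronglyMeasurable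
      · refine IntegrableOn.integrable_indicator ?_ measurableSet_closedBall
        exact integrableOn_const (measure_closedBall_lt_top.ne)
      · refine fun k => Eventually.of_forall fun z => ?_
        by_cases hz : z ∈ closedBall x r
        · rw [indicator_of_mem hz, norm_mul]
          gcongr
          · exact hA _
          · exact hM _ z hz
        · rw [indicator_of_notMem hz, peak_kernel_zero K.supp hr hz]
          simp
      · refine Eventually.of_forall fun z => ?_
        by_cases hz : z ∈ closedBall x r
        · exact (hf z (hx hz)).const_mul _
        · rw [peak_kernel_zero K.supp hr hz]
          simp
    refine tendsto_nhds_unique (hf x (hx (mem_closedBall_self hr.le))) ?_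
    refine (h1.const_mul ((r ^ n)⁻¹)).congr fun k => ?_
    exact ((hu (φ k)).zform hr hx).symm

theorem ball_infDist_frontier_subset {n : ℕ} {G : Set (EuclideanSpace ℝ (Fin n))} (hG : IsOpen G)
    {x : EuclideanSpace ℝ (Fin n)} (hx : x ∈ G) : ball x (infDist x (frontier G)) ⊆ G := by
  rcases le_or_gt (infDist x (frontier G)) 0 with h | h
  · rw [ball_eq_empty.2 h]; exact empty_subset _
  refine (convex_ball x _).isPreconnected.subset_of_closure_inter_subset hG
    ⟨x, mem_ball_self h, hx⟩ ?_
  rintro z ⟨hzc, hzb⟩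
  by_contra hz
  have hzf : z ∈ frontier G := ⟨hzc, by rwa [hG.interior_eq]⟩
  have h1 := infDist_le_dist_of_mem (x := x) hzf
  rw [mem_ball, dist_comm] at hzb
  linarith

theorem peak_not_null {n : ℕ} (G : Set (EuclideanSpace ℝ (Fin n)))
    (hGo : IsOpen G) (hfr : (frontier G).Nonempty)
    (F : Set (EuclideanSpace ℝ (Fin n))) (hFG : F ⊆ G) (hn : n ≠ 0)
    (hint : IntegrableOn (fun x => (Metric.infDist x (frontier G)) ^ (-(n : ℝ))) F) :
    volume (G \ F) ≠ 0 := by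
  intro hnull
  have hGint : IntegrableOn (fun x => (Metric.infDist x (frontier G)) ^ (-(n : ℝ))) G := by
    refine hint.congr_set_ae ?_
    refine Filter.EventuallyLE.antisymm ?_ hFG.eventuallyLE
    exact ae_le_set.2 hnull
  have hdpos : ∀ x ∈ G, 0 < infDist x (frontier G) := by
    intro x hx
    refine (isClosed_frontier.notMem_iff_infDist_pos hfr).1 ?_
    intro h
    exact h.2 (by rwa [hGo.interior_eq])
  let V : ℝ := (volume : Measure (EuclideanSpace ℝ (Fin n))).real (ball 0 1)
  have hV : 0 < V := by
    refine ENNReal.toReal_pos (measure_ball_pos _ _ one_pos).ne' measure_ball_lt_top.ne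
  obtain ⟨p, hp⟩ := hfr
  have hpc : ∀ k : ℕ, ∃ x ∈ G, infDist x (frontier G) < 1 / ((k : ℝ) + 1) := by
    intro k
    obtain ⟨x, hx, hxd⟩ := Metric.mem_closure_iff.1 hp.1 (1 / ((k : ℝ) + 1)) (by positivity)
    refine ⟨x, hx, (infDist_le_dist_of_mem hp).trans_lt ?_⟩
    rwa [dist_comm]
  choose x hxG hxd using hpc
  let d : ℕ → ℝ := fun k => infDist (x k) (frontier G)
  have hd : ∀ k, 0 < d k := fun k => hdpos _ (hxG k)
  let B : ℕ → Set (EuclideanSpace ℝ (Fin n)) := fun k => closedBall (x k) (d k / 2)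
  have hBG : ∀ k, B k ⊆ G := fun k =>
    (closedBall_subset_ball (by linarith [hd k])).trans (ball_infDist_frontier_subset hGo (hxG k))
  have hvol : ∀ k, volume.real (B k) = (d k / 2) ^ n * V := by
    intro k
    have := Measure.addHaar_real_closedBall (volume : Measure (EuclideanSpace ℝ (Fin n))) (x k)
      (by linarith [hd k] : 0 ≤ d k / 2)
    simpa using this
  have hlow : ∀ k, (3 ^ n : ℝ)⁻¹ * V ≤
      ∫ z in B k, (Metric.infDist z (frontier G)) ^ (-(n : ℝ)) ∂(volume.restrict G) := by
    intro k
    rw [Measure.restrict_restrict measurableSet_closedBall, inter_eq_left.2 (hBG k)]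
    have h1 : ∫ z in B k, ((3 * (d k / 2)) ^ n)⁻¹ ≤
        ∫ z in B k, (Metric.infDist z (frontier G)) ^ (-(n : ℝ)) := by
      refine setIntegral_mono_on (integrableOn_const measure_closedBall_lt_top.ne)
        (hGint.mono_set (hBG k)) measurableSet_closedBall ?_
      intro z hz
      have hz0 := hdpos z (hBG k hz)
      rw [Real.rpow_neg hz0.le, Real.rpow_natCast]
      gcongr
      have := infDist_le_infDist_add_dist (s := frontier G) (x := z) (y := x k)
      have h2 := mem_closedBall.1 hz
      simp only [d] at h2 ⊢
      linarith
    refine le_trans (le_of_eq ?_) h1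
    rw [setIntegral_const, hvol, smul_eq_mul, mul_pow]
    have := hd k
    field_simp
  have htend : Tendsto (fun k => ((volume : Measure (EuclideanSpace ℝ (Fin n))).restrict G) (B k)) atTop (𝓝 0) := by
    have h1 : ∀ k, ((volume : Measure (EuclideanSpace ℝ (Fin n))).restrict G) (B k) =
        ENNReal.ofReal ((d k / 2) ^ n * V) := by
      intro k
      rw [Measure.restrict_apply measurableSet_closedBall, inter_eq_left.2 (hBG k), ← hvol]
      exact (ENNReal.ofReal_toReal measure_closedBall_lt_top.ne).symm
    simp_rw [h1]
    have hd0 : Tendsto d atTop (𝓝 0) :=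
      squeeze_zero (fun k => (hd k).le) (fun k => (hxd k).le) tendsto_one_div_add_atTop_nhds_zero_nat
    have h2 : Tendsto (fun k => ENNReal.ofReal ((d k / 2) ^ n * V)) atTop
        (𝓝 (ENNReal.ofReal ((0 / 2) ^ n * V))) :=
      ENNReal.tendsto_ofReal (((hd0.div_const 2).pow n).mul_const V)
    simpa [hn] using h2
  have := hGint.tendsto_setIntegral_nhds_zero htend
  have h2 := ge_of_tendsto' this hlow
  have : 0 < (3 ^ n : ℝ)⁻¹ * V := by positivity
  linarith


theorem PeakMV.const_mul {n : ℕ} {ψ f : EuclideanSpace ℝ (Fin n) → ℝ}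
    {G : Set (EuclideanSpace ℝ (Fin n))} (hf : PeakMV ψ G f) (c : ℝ) :
    PeakMV ψ G (fun x => c * f x) := by
  refine ⟨continuousOn_const.mul hf.1, ?_⟩
  intro x r hr hx
  simp only
  rw [hf.2 x r hr hx, ← integral_const_mul]
  congr 1
  ext y
  ring

theorem peak_main (n : ℕ) (hn : 2 ≤ n) (G : Set (EuclideanSpace ℝ (Fin n)))
    (hGo : IsOpen G) (hGc : IsConnected G) (hGb : Bornology.IsBounded G)
    (F : Set (EuclideanSpace ℝ (Fin n))) (hFG : F ⊆ G) (hFm : MeasurableSet F)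
    (hint : IntegrableOn (fun x => (Metric.infDist x (frontier G)) ^ (-(n : ℝ))) F) :
    ∃ M : ℝ, ∀ h : EuclideanSpace ℝ (Fin n) → ℝ, HarmonicOn h G → IntegrableOn h G →
      (∫ x in F, |h x|) ≤ M * ∫ x in G \ F, |h x| := by
  by_contra hcon
  push Not at hcon
  obtain ⟨P, ψ, K⟩ := exists_peakKernel n
  have hnt : Nontrivial (EuclideanSpace ℝ (Fin n)) := by
    have : Nonempty (Fin n) := ⟨⟨0, by omega⟩⟩
    infer_instance
  have hfr : (frontier G).Nonempty := by
    rw [nonempty_frontier_iff]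
    refine ⟨hGc.nonempty, ?_⟩
    rintro rfl
    exact NormedSpace.unbounded_univ ℝ (EuclideanSpace ℝ (Fin n)) hGb
  have hnull := peak_not_null G hGo hfr F hFG (by omega) hint
  have hdpos : ∀ x ∈ G, 0 < infDist x (frontier G) := by
    intro x hx
    refine (isClosed_frontier.notMem_iff_infDist_pos hfr).1 ?_
    intro h
    exact h.2 (by rwa [hGo.interior_eq])
  obtain ⟨A, hA⟩ := (PeakKernel.compact_of_supp K.supp).exists_bound_of_continuous
    K.smooth.continuous
  have hA0 : 0 ≤ A := (norm_nonneg _).trans (hA 0)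
  have hGFm : MeasurableSet (G \ F) := hGo.measurableSet.diff hFm
  -- the normalized sequence
  have hseq : ∀ k : ℕ, ∃ u : EuclideanSpace ℝ (Fin n) → ℝ, PeakMV ψ G u ∧ IntegrableOn u G ∧
      ∫ x in F, |u x| = 1 ∧ ∫ x in G \ F, |u x| ≤ 1 / ((k : ℝ) + 1) := by
    intro k
    obtain ⟨h, hh, hhi, hlt⟩ := hcon ((k : ℝ) + 1)
    have h0 : 0 ≤ ∫ x in G \ F, |h x| := integral_nonneg fun _ => abs_nonneg _
    have hpos : 0 < ∫ x in F, |h x| := lt_of_le_of_lt (by positivity) hlt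
    set I := ∫ x in F, |h x| with hI
    refine ⟨fun x => I⁻¹ * h x, (hh.peakMV K hGo).const_mul _, hhi.const_mul _, ?_, ?_⟩
    · simp only [abs_mul, integral_const_mul, abs_of_pos (inv_pos.2 hpos)]
      rw [← hI, inv_mul_cancel₀ hpos.ne']
    · simp only [abs_mul, integral_const_mul, abs_of_pos (inv_pos.2 hpos)]
      rw [inv_mul_eq_div, div_le_div_iff₀ hpos (by positivity)]
      linarith
  choose u hu hui hu1 hu2 using hseq
  have htot : ∀ k, ∫ x in G, |u k x| ≤ 2 := by
    intro k
    have h1 : ∫ x in G, |u k x| = (∫ x in F, |u k x|) + ∫ x in G \ F, |u k x| := by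
      rw [← setIntegral_union disjoint_sdiff_right hGFm (((hui k).mono_set hFG).abs)
        (((hui k).mono_set sdiff_subset).abs), union_sdiff_cancel hFG]
    rw [h1, hu1]
    have h2 := hu2 k
    have h3 : 1 / ((k : ℝ) + 1) ≤ 1 := by
      rw [div_le_one (by positivity)]
      linarith [(Nat.cast_nonneg k : (0 : ℝ) ≤ k)]
    linarith
  have hpt : ∀ x r, 0 < r → closedBall x r ⊆ G → ∀ k, |u k x| ≤ (r ^ n)⁻¹ * (A * 2) := by
    intro x r hr hx k
    refine ((hu k).l1_bound K hGo (hui k) hA hr hx).trans ?_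
    gcongr
    exact htot k
  obtain ⟨φ, hφ, f, hf, hlim⟩ := K.compactness hGo u hu (by
    intro x r hr hx
    obtain ⟨δ, hδ, h⟩ := (isCompact_closedBall x r).exists_cthickening_subset_open hGo hx
    rw [cthickening_closedBall hδ.le hr.le] at h
    refine ⟨(δ ^ n)⁻¹ * (A * 2), fun k y hy => hpt y δ hδ ?_ k⟩
    refine Subset.trans (closedBall_subset_closedBall' ?_) h
    have := mem_closedBall.1 hy
    linarith)
  -- integral over F
  have hF1 : Tendsto (fun k => ∫ x in F, |u (φ k) x|) atTop (𝓝 (∫ x in F, |f x|)) := by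
    refine tendsto_integral_of_dominated_convergence
      (fun x => 2 ^ n * (A * 2) * (infDist x (frontier G)) ^ (-(n : ℝ))) ?_ ?_ ?_ ?_
    · exact fun k => (((hui (φ k)).mono_set hFG).abs).aestronglyMeasurable
    · exact hint.const_mul _
    · intro k
      filter_upwards [ae_restrict_mem hFm] with x hx
      have hd := hdpos x (hFG hx)
      have := hpt x (infDist x (frontier G) / 2) (by positivity)
        ((closedBall_subset_ball (by linarith)).trans (ball_infDist_frontier_subset hGo (hFG hx)))
        (φ k)
      rw [Real.norm_eq_abs, abs_abs, Real.rpow_neg hd.le, Real.rpow_natCast]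
      refine this.trans (le_of_eq ?_)
      rw [div_pow, inv_div]
      field_simp
    · filter_upwards [ae_restrict_mem hFm] with x hx
      exact (hlim x (hFG hx)).abs
  have hF2 : ∫ x in F, |f x| = 1 := by
    refine tendsto_nhds_unique hF1 ?_
    simp only [hu1]
    exact tendsto_const_nhds
  -- vanishing off F
  have hae : ∀ᵐ x, x ∈ G \ F → f x = 0 := by
    rw [← ae_restrict_iff' hGFm]
    have hlin : ∀ k, ∫⁻ x in G \ F, ENNReal.ofReal |u (φ k) x| ≤
        ENNReal.ofReal (1 / ((φ k : ℝ) + 1)) := by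
      intro k
      rw [← ofReal_integral_eq_lintegral_ofReal (((hui (φ k)).mono_set sdiff_subset).abs)
        (Eventually.of_forall fun _ => abs_nonneg _)]
      exact ENNReal.ofReal_le_ofReal (hu2 (φ k))
    have hto : Tendsto (fun k => ENNReal.ofReal (1 / ((φ k : ℝ) + 1))) atTop (𝓝 0) := by
      have h1 := (tendsto_one_div_add_atTop_nhds_zero_nat (𝕜 := ℝ)).comp hφ.tendsto_atTop
      have := ENNReal.tendsto_ofReal h1
      simpa using this
    have hto2 : Tendsto (fun k => ∫⁻ x in G \ F, ENNReal.ofReal |u (φ k) x|) atTop (𝓝 0) :=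
      tendsto_of_tendsto_of_tendsto_of_le_of_le tendsto_const_nhds hto (fun _ => zero_le) hlin
    have hmeas : ∀ k, AEMeasurable (fun x => ENNReal.ofReal |u (φ k) x|)
        (volume.restrict (G \ F)) := fun k =>
      (((hui (φ k)).mono_set sdiff_subset).abs).aestronglyMeasurable.aemeasurable.ennreal_ofReal
    have hfatou := lintegral_liminf_le' (u := atTop) hmeas
    rw [hto2.liminf_eq, nonpos_iff_eq_zero] at hfatou
    have hfm : AEMeasurable (fun x => ENNReal.ofReal |f x|) (volume.restrict (G \ F)) := by
      have h1 : AEMeasurable f (volume.restrict (G \ F)) :=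
        (hf.1.aemeasurable hGo.measurableSet).mono_measure
          (Measure.restrict_mono sdiff_subset le_rfl)
      have h2 : AEMeasurable (fun x => |f x|) (volume.restrict (G \ F)) := h1.norm
      exact h2.ennreal_ofReal
    have hfz : ∫⁻ x in G \ F, ENNReal.ofReal |f x| = 0 := by
      rw [← hfatou]
      refine setLIntegral_congr_fun hGFm fun x hx => ?_
      exact (ENNReal.tendsto_ofReal (hlim x hx.1).abs).liminf_eq.symm
    rw [lintegral_eq_zero_iff' hfm] at hfz
    filter_upwards [hfz] with x hx
    simpa using hx
  have hzero := hf.unique_continuation K hGo hGc.isPreconnected hGFm sdiff_subset hnull hae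
  have : ∫ x in F, |f x| = 0 := by
    rw [setIntegral_congr_fun hFm (g := fun _ => 0) (fun x hx => by simp [hzero x (hFG hx)])]
    simp
  linarith


end PeakAux

/-- Theorem 5.9: if `G` is a bounded domain in `ℝⁿ` and `F ⊆ G` satisfies
`∫_F dist(x, ∂G)^{−n} dx < ∞`, then `F` is not a weak peak set for `L¹_h(G)`. -/
theorem stmt_13 (n : ℕ) (hn : 2 ≤ n) (G : Set (EuclideanSpace ℝ (Fin n)))
    (hGo : IsOpen G) (hGc : IsConnected G) (hGb : Bornology.IsBounded G)
    (F : Set (EuclideanSpace ℝ (Fin n))) (hFG : F ⊆ G) (hFm : MeasurableSet F)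
    (hint : IntegrableOn (fun x => (Metric.infDist x (frontier G)) ^ (-(n : ℝ))) F) :
    ∃ M : ℝ, ∀ h : EuclideanSpace ℝ (Fin n) → ℝ, HarmonicOn h G → IntegrableOn h G →
      (∫ x in F, |h x|) ≤ M * ∫ x in G \ F, |h x| := by
  exact peak_main n hn G hGo hGc hGb F hFG hFm hint
end
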